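/- arXiv:2503.18106 — 3 statements merged into one kernel-verified Lean document; each statement's English description precedes it below -/
import Mathlib

section
/- Let a, b, c, d be real numbers with a·d − b·c > 0. Then there exist smooth functions f, g : ℝ → ℝ and a real number ε with 0 < ε < 1/2 such that: (1) f(r) = 1 and g(r) = r² for all r ≤ ε; (2) f(r) = a + b·r and g(r) = c + d·r for all r ≥ 1 − ε; and (3) f(r)·g'(r) − f'(r)·g(r) > 0 for all r ∈ (0, 1]. -/
/-!
Radial-profile lemma (Step 2 of the main theorem): existence of smooth radial
profiles `f, g` for a contact form `f(r) dφ + g(r) dθ` on a solid torus,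
interpolating between the model `(1, r²)` near the core and prescribed affine
boundary values `(a + b r, c + d r)` satisfying the contact condition
`a d - b c > 0`, with `f g' - f' g > 0` on `(0, 1]`.
-/

open Real in
/-- An affine path with positive Wronskian has a smooth polar representation with strictly
increasing angle, and the angle can be taken larger than `π / 2`. -/
lemma exists_polar_affine (a b c d : ℝ) (h : 0 < a * d - b * c) :
    ∃ ρ θ : ℝ → ℝ, ContDiff ℝ (⊤ : ℕ∞) ρ ∧ ContDiff ℝ (⊤ : ℕ∞) θ ∧
      (∀ r, 0 < ρ r) ∧ (∀ r, π / 2 < θ r) ∧ (∀ r, 0 < deriv θ r) ∧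
      (∀ r, ρ r * cos (θ r) = a + b * r) ∧ (∀ r, ρ r * sin (θ r) = c + d * r) := by
  set D := a * d - b * c with hD
  let z : ℂ := ⟨d, -b⟩
  have hz : z ≠ 0 := by
    intro hz
    have hd : d = 0 := congrArg Complex.re hz
    have hb : -b = 0 := congrArg Complex.im hz
    have hb' : b = 0 := by linarith
    simp [hD, hd, hb'] at h
  have hn : 0 < ‖z‖ := norm_pos_iff.2 hz
  have hN : ‖z‖ ^ 2 = b ^ 2 + d ^ 2 := by
    rw [Complex.sq_norm, Complex.normSq_apply]
    simp only [z]
    ring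
  have hcos : cos z.arg = d / ‖z‖ := Complex.cos_arg hz
  have hsin : sin z.arg = -b / ‖z‖ := Complex.sin_arg z
  let x : ℝ → ℝ := fun r => ((b ^ 2 + d ^ 2) * r + (a * b + c * d)) / D
  have hx (r : ℝ) : HasDerivAt x ((b ^ 2 + d ^ 2) / D) r := by
    simpa using (((hasDerivAt_id r).const_mul (b ^ 2 + d ^ 2)).add_const
      (a * b + c * d)).div_const D
  have hxs : ContDiff ℝ (⊤ : ℕ∞) x := by fun_prop
  have hpos (r : ℝ) : 0 < 1 + x r ^ 2 := by positivity
  refine ⟨fun r => D / ‖z‖ * √(1 + x r ^ 2), fun r => z.arg + 2 * π + arctan (x r),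
    contDiff_const.mul ((contDiff_const.add (hxs.pow 2)).sqrt fun r => (hpos r).ne'),
    contDiff_const.add hxs.arctan, fun r => mul_pos (div_pos h hn) (sqrt_pos.2 (hpos r)),
    fun r => ?_, fun r => ?_, fun r => ?_, fun r => ?_⟩
  · linarith [Complex.neg_pi_lt_arg z, neg_pi_div_two_lt_arctan (x r)]
  · rw [((hx r).arctan.const_add _).deriv, ← hN]
    have := hpos r
    positivity
  · have hs := (sqrt_pos.2 (hpos r)).ne'
    dsimp only
    rw [cos_add, cos_add_two_pi, sin_add_two_pi, hcos, hsin, cos_arctan, sin_arctan]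
    trans D / ‖z‖ ^ 2 * (d + b * x r)
    · field_simp
      ring
    · have hN' : b ^ 2 + d ^ 2 ≠ 0 := by rw [← hN]; positivity
      rw [hN]
      simp only [x]
      field_simp
      rw [hD]
      ring
  · have hs := (sqrt_pos.2 (hpos r)).ne'
    dsimp only
    rw [sin_add, cos_add_two_pi, sin_add_two_pi, hcos, hsin, cos_arctan, sin_arctan]
    trans D / ‖z‖ ^ 2 * (-b + d * x r)
    · field_simp
    · have hN' : b ^ 2 + d ^ 2 ≠ 0 := by rw [← hN]; positivity
      rw [hN]
      simp only [x]
      field_simp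
      rw [hD]
      ring

/-- The Wronskian of a plane path in polar coordinates is `ρ ^ 2 * θ'`. -/
lemma wronskian_polar {ρ θ : ℝ → ℝ} {r ρ' θ' : ℝ} (hρ : HasDerivAt ρ ρ' r)
    (hθ : HasDerivAt θ θ' r) :
    ρ r * Real.cos (θ r) * deriv (fun t => ρ t * Real.sin (θ t)) r -
      deriv (fun t => ρ t * Real.cos (θ t)) r * (ρ r * Real.sin (θ r)) = ρ r ^ 2 * θ' := by
  rw [(hρ.fun_mul hθ.sin).deriv, (hρ.fun_mul hθ.cos).deriv]
  linear_combination ρ r ^ 2 * θ' * Real.cos_sq_add_sin_sq (θ r)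

theorem radial_profile_exists (a b c d : ℝ) (h : a * d - b * c > 0) :
    ∃ (f g : ℝ → ℝ) (ε : ℝ),
      ContDiff ℝ (⊤ : ℕ∞) f ∧ ContDiff ℝ (⊤ : ℕ∞) g ∧
      0 < ε ∧ ε < 1 / 2 ∧
      (∀ r : ℝ, r ≤ ε → f r = 1 ∧ g r = r ^ 2) ∧
      (∀ r : ℝ, 1 - ε ≤ r → f r = a + b * r ∧ g r = c + d * r) ∧
      (∀ r ∈ Set.Ioc (0 : ℝ) 1, f r * deriv g r - deriv f r * g r > 0) := by
  obtain ⟨ρ₁, θ₁, hρ₁, hθ₁, hρ₁pos, hθ₁gt, hθ₁', hcos, hsin⟩ := exists_polar_affine a b c d h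
  let χ : ℝ → ℝ := fun r => Real.smoothTransition (3 * r - 1)
  have hχ : ContDiff ℝ (⊤ : ℕ∞) χ :=
    Real.smoothTransition.contDiff.comp (by fun_prop : ContDiff ℝ (⊤ : ℕ∞) fun r : ℝ => 3 * r - 1)
  have hχmono : Monotone χ := fun s t hst => Real.smoothTransition.monotone (by linarith)
  have hχ0 (r : ℝ) : 0 ≤ χ r := Real.smoothTransition.nonneg _
  have hχ1 (r : ℝ) : χ r ≤ 1 := Real.smoothTransition.le_one _
  let ρ₀ : ℝ → ℝ := fun r => √(1 + (r ^ 2) ^ 2)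
  let θ₀ : ℝ → ℝ := fun r => Real.arctan (r ^ 2)
  have hpos (r : ℝ) : 0 < 1 + (r ^ 2) ^ 2 := by positivity
  have hρ₀pos (r : ℝ) : 0 < ρ₀ r := Real.sqrt_pos.2 (hpos r)
  have hρ₀ : ContDiff ℝ (⊤ : ℕ∞) ρ₀ :=
    ContDiff.sqrt (by fun_prop) fun r => (hpos r).ne'
  have hθ₀ : ContDiff ℝ (⊤ : ℕ∞) θ₀ := (contDiff_id.pow 2).arctan
  have hθ₀' (r : ℝ) (hr : 0 < r) : 0 < deriv θ₀ r := by
    rw [((hasDerivAt_pow 2 r).arctan).deriv]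
    positivity
  let ρ : ℝ → ℝ := fun r => ρ₀ r + χ r * (ρ₁ r - ρ₀ r)
  let θ : ℝ → ℝ := fun r => θ₀ r + χ r * (θ₁ r - θ₀ r)
  have hρ : ContDiff ℝ (⊤ : ℕ∞) ρ := hρ₀.add (hχ.mul (hρ₁.sub hρ₀))
  have hθ : ContDiff ℝ (⊤ : ℕ∞) θ := hθ₀.add (hχ.mul (hθ₁.sub hθ₀))
  have hder {u : ℝ → ℝ} (hu : ContDiff ℝ (⊤ : ℕ∞) u) (r : ℝ) : HasDerivAt u (deriv u r) r :=
    (hu.differentiable (by simp) r).hasDerivAt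
  refine ⟨fun r => ρ r * Real.cos (θ r), fun r => ρ r * Real.sin (θ r), 1 / 3,
    hρ.mul hθ.cos, hρ.mul hθ.sin, by norm_num, by norm_num, fun r hr => ?_, fun r hr => ?_,
    fun r hr => ?_⟩
  · have hχr : χ r = 0 := Real.smoothTransition.zero_of_nonpos (by linarith)
    have hs := (hρ₀pos r).ne'
    simp only [ρ, θ, hχr, zero_mul, add_zero]
    simp only [ρ₀, θ₀, Real.cos_arctan, Real.sin_arctan] at hs ⊢
    constructor <;> field_simp
  · have hχr : χ r = 1 := Real.smoothTransition.one_of_one_le (by linarith)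
    simp only [ρ, θ, hχr, one_mul, add_sub_cancel]
    exact ⟨hcos r, hsin r⟩
  · rw [wronskian_polar (hder hρ r)
      ((hder hθ₀ r).fun_add ((hder hχ r).fun_mul ((hder hθ₁ r).fun_sub (hder hθ₀ r))))]
    have hρpos : 0 < ρ r := by
      rcases (hχ0 r).eq_or_lt with h0 | h0
      · simpa [ρ, ← h0] using hρ₀pos r
      · nlinarith [mul_pos h0 (hρ₁pos r), mul_nonneg (sub_nonneg.2 (hχ1 r)) (hρ₀pos r).le]
    refine mul_pos (pow_pos hρpos 2) ?_
    have hgap : 0 ≤ deriv χ r * (θ₁ r - θ₀ r) :=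
      mul_nonneg hχmono.deriv_nonneg
        (by linarith [hθ₁gt r, Real.arctan_lt_pi_div_two (r ^ 2)])
    have h0 := hθ₀' r hr.1
    rcases (hχ0 r).eq_or_lt with hχr | hχr
    · simp only [← hχr, zero_mul, add_zero]
      linarith
    · nlinarith [mul_pos hχr (hθ₁' r), mul_nonneg (sub_nonneg.2 (hχ1 r)) h0.le]
end

section
/- (Wrinkling a transverse arc off a point.) Let γ : [0,1] → ℝ³ be a smooth embedding of an arc that is positively transverse to ξ_std, let t₀ ∈ (0,1), set p = γ(t₀), and let ε > 0. Then there exists a smooth map H : [0,1] × [0,1] → ℝ³ and δ > 0 such that: (1) H(0, t) = γ(t) for all t; (2) for each s ∈ [0,1], the map H(s, ·) : [0,1] → ℝ³ is a smooth embedding that is positively transverse to ξ_std; (3) H(s, t) = γ(t) whenever t ≤ δ or t ≥ 1 − δ (the isotopy is fixed near the endpoints); (4) ‖H(s,t) − γ(t)‖ < ε for all s, t; and (5) p is not in the image of H(1, ·). -/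
/-!
Wrinkling a transverse arc off a point (Step 4 of the main theorem).

We model ℝ³ as `ℝ × ℝ × ℝ` with coordinates `(x, y, z)`, and an arc as a map
`γ : ℝ → ℝ³` restricted to `[0,1]`.  Positive transversality to
`ξ_std = ker (dz - y dx)` along the arc reads `z' - y * x' > 0`.
-/

open Set

/-- `γ` restricted to `[0,1]` is a smooth embedded arc positively transverse
to the standard contact structure on ℝ³. -/
noncomputable def IsTransverseArc (γ : ℝ → ℝ × ℝ × ℝ) : Prop :=
  ContDiffOn ℝ (⊤ : ℕ∞) γ (Icc 0 1) ∧
  InjOn γ (Icc 0 1) ∧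
  (∀ t ∈ Icc (0 : ℝ) 1, derivWithin γ (Icc 0 1) t ≠ 0) ∧
  ∀ t ∈ Icc (0 : ℝ) 1,
    derivWithin (fun s => (γ s).2.2) (Icc 0 1) t
      - (γ t).2.1 * derivWithin (fun s => (γ s).1) (Icc 0 1) t > 0

/-- A smooth map on `[0,1]` on which `dz - y dx` is positive has nonvanishing derivative. -/
theorem derivWithin_ne_zero_of_transverse {γ : ℝ → ℝ × ℝ × ℝ}
    (hγ : ContDiffOn ℝ (⊤ : ℕ∞) γ (Icc 0 1)) {t : ℝ} (ht : t ∈ Icc (0 : ℝ) 1)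
    (hpos : derivWithin (fun s => (γ s).2.2) (Icc 0 1) t
      - (γ t).2.1 * derivWithin (fun s => (γ s).1) (Icc 0 1) t > 0) :
    derivWithin γ (Icc 0 1) t ≠ 0 := by
  intro h0
  have hu : UniqueDiffWithinAt ℝ (Icc (0 : ℝ) 1) t := uniqueDiffOn_Icc_zero_one t ht
  have hd : HasDerivWithinAt γ 0 (Icc 0 1) t := by
    rw [← h0]
    exact ((hγ.differentiableOn (by simp)) t ht).hasDerivWithinAt
  have hx : HasDerivWithinAt (fun s => (γ s).1) 0 (Icc 0 1) t :=
    (ContinuousLinearMap.fst ℝ ℝ (ℝ × ℝ)).hasFDerivAt.comp_hasDerivWithinAt t hd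
  have hz : HasDerivWithinAt (fun s => (γ s).2.2) 0 (Icc 0 1) t :=
    ((ContinuousLinearMap.snd ℝ ℝ ℝ).comp
      (ContinuousLinearMap.snd ℝ ℝ (ℝ × ℝ))).hasFDerivAt.comp_hasDerivWithinAt t hd
  rw [hx.derivWithin hu, hz.derivWithin hu] at hpos
  simp at hpos

/-- Near an interior point `t₀`, the contact form frozen at `γ t₀` is injective along a
transverse arc. -/
theorem IsTransverseArc.exists_injOn_ball {γ : ℝ → ℝ × ℝ × ℝ} (hγ : IsTransverseArc γ)
    {t₀ : ℝ} (ht₀ : t₀ ∈ Ioo (0 : ℝ) 1) :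
    ∃ r > 0, r ≤ t₀ ∧ r ≤ 1 - t₀ ∧
      InjOn (fun t => (γ t).2.2 - (γ t₀).2.1 * (γ t).1) (Metric.ball t₀ r) := by
  obtain ⟨hsm, -, -, htr⟩ := hγ
  have hx : ContDiffOn ℝ (⊤ : ℕ∞) (fun t => (γ t).1) (Icc 0 1) := hsm.fst
  have hz : ContDiffOn ℝ (⊤ : ℕ∞) (fun t => (γ t).2.2) (Icc 0 1) := hsm.snd.snd
  have hU := uniqueDiffOn_Icc_zero_one
  have hx' := hx.continuousOn_derivWithin hU (by simp)
  have hz' := hz.continuousOn_derivWithin hU (by simp)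
  have hnhds : Icc (0 : ℝ) 1 ∈ nhds t₀ := Icc_mem_nhds ht₀.1 ht₀.2
  have hc : ContinuousAt (fun t => derivWithin (fun s => (γ s).2.2) (Icc 0 1) t
      - (γ t₀).2.1 * derivWithin (fun s => (γ s).1) (Icc 0 1) t) t₀ :=
    (hz'.sub (continuousOn_const.mul hx')).continuousAt hnhds
  obtain ⟨r, hr, hball⟩ := Metric.eventually_nhds_iff_ball.1
    (hc.eventually_const_lt (htr t₀ (Ioo_subset_Icc_self ht₀)))
  refine ⟨min r (min t₀ (1 - t₀)), lt_min hr (lt_min ht₀.1 (by linarith [ht₀.2])),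
    (min_le_right _ _).trans (min_le_left _ _), (min_le_right _ _).trans (min_le_right _ _), ?_⟩
  set ρ := min r (min t₀ (1 - t₀))
  have hsub : Metric.ball t₀ ρ ⊆ Ioo 0 1 := by
    intro t ht
    have h1 : ρ ≤ t₀ := (min_le_right _ _).trans (min_le_left _ _)
    have h2 : ρ ≤ 1 - t₀ := (min_le_right _ _).trans (min_le_right _ _)
    rw [Real.ball_eq_Ioo] at ht
    exact ⟨by linarith [ht.1], by linarith [ht.2]⟩
  have hmono : StrictMonoOn (fun t => (γ t).2.2 - (γ t₀).2.1 * (γ t).1) (Metric.ball t₀ ρ) := by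
    refine strictMonoOn_of_deriv_pos (convex_ball _ _) ?_ ?_
    · exact (hz.continuousOn.sub (continuousOn_const.mul hx.continuousOn)).mono
        (hsub.trans Ioo_subset_Icc_self)
    · intro t ht
      rw [Metric.isOpen_ball.interior_eq] at ht
      have htI := hsub ht
      have hn : Icc (0 : ℝ) 1 ∈ nhds t := Icc_mem_nhds htI.1 htI.2
      have hdx := ((hx.differentiableOn (by simp)) t
        (Ioo_subset_Icc_self htI)).hasDerivWithinAt.hasDerivAt hn
      have hdz := ((hz.differentiableOn (by simp)) t
        (Ioo_subset_Icc_self htI)).hasDerivWithinAt.hasDerivAt hn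
      have hd : HasDerivAt (fun t => (γ t).2.2 - (γ t₀).2.1 * (γ t).1) _ t :=
        hdz.sub (hdx.const_mul (γ t₀).2.1)
      rw [hd.deriv]
      exact hball t (Metric.ball_subset_ball (min_le_left _ _) ht)
  exact hmono.injOn

/-- Distances between the parts of an embedded arc over `closedBall t₀ (r / 2)` and over the
complement of `ball t₀ r` are bounded below. -/
theorem exists_pos_le_norm_sub {γ : ℝ → ℝ × ℝ × ℝ} (hc : ContinuousOn γ (Icc 0 1))
    (hinj : InjOn γ (Icc 0 1)) (t₀ : ℝ) {r : ℝ} (hr : 0 < r) :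
    ∃ m > 0, ∀ a ∈ Icc (0 : ℝ) 1, ∀ b ∈ Icc (0 : ℝ) 1,
      a ∈ Metric.closedBall t₀ (r / 2) → b ∉ Metric.ball t₀ r → m ≤ ‖γ a - γ b‖ := by
  have hK : IsCompact ((Icc (0 : ℝ) 1 ∩ Metric.closedBall t₀ (r / 2)) ×ˢ
      (Icc (0 : ℝ) 1 \ Metric.ball t₀ r)) :=
    (isCompact_Icc.inter_right Metric.isClosed_closedBall).prod
      (isCompact_Icc.diff Metric.isOpen_ball)
  have hf : ContinuousOn (fun q : ℝ × ℝ => ‖γ q.1 - γ q.2‖)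
      ((Icc (0 : ℝ) 1 ∩ Metric.closedBall t₀ (r / 2)) ×ˢ (Icc (0 : ℝ) 1 \ Metric.ball t₀ r)) :=
    ((hc.comp continuousOn_fst fun _ hq => hq.1.1).sub
      (hc.comp continuousOn_snd fun _ hq => hq.2.1)).norm
  obtain ⟨m, hm, hle⟩ := hK.exists_forall_le' hf (a := 0) (by
    rintro ⟨a, b⟩ ⟨⟨ha, ha'⟩, hb, hb'⟩
    rw [norm_pos_iff, sub_ne_zero]
    intro h
    obtain rfl : a = b := hinj ha hb h
    exact hb' (Metric.closedBall_subset_ball (by linarith) ha'))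
  exact ⟨m, hm, fun a ha b hb ha₂ hb₂ => hle (a, b) ⟨⟨ha, ha₂⟩, hb, hb₂⟩⟩

/-- Transversality persists under perturbations of the `y`-coordinate of uniformly small size. -/
theorem IsTransverseArc.exists_pos_mul_lt {γ : ℝ → ℝ × ℝ × ℝ} (hγ : IsTransverseArc γ) :
    ∃ w > 0, ∀ t ∈ Icc (0 : ℝ) 1, ∀ h : ℝ, |h| < w →
      derivWithin (fun s => (γ s).2.2) (Icc 0 1) t
        - ((γ t).2.1 + h) * derivWithin (fun s => (γ s).1) (Icc 0 1) t > 0 := by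
  obtain ⟨hsm, -, -, htr⟩ := hγ
  have hU := uniqueDiffOn_Icc_zero_one
  have hx' := hsm.fst.continuousOn_derivWithin hU (by simp)
  have hz' := hsm.snd.snd.continuousOn_derivWithin hU (by simp)
  have hf : ContinuousOn (fun t => (derivWithin (fun s => (γ s).2.2) (Icc 0 1) t
      - (γ t).2.1 * derivWithin (fun s => (γ s).1) (Icc 0 1) t) /
      (1 + |derivWithin (fun s => (γ s).1) (Icc 0 1) t|)) (Icc 0 1) :=
    (hz'.sub (hsm.continuousOn.snd.fst.mul hx')).div (continuousOn_const.add hx'.abs)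
      fun t _ => by positivity
  obtain ⟨w, hw, hle⟩ := isCompact_Icc.exists_forall_le' hf (a := 0) fun t ht =>
    div_pos (htr t ht) (by positivity)
  refine ⟨w, hw, fun t ht h hh => ?_⟩
  have h1 := hle t ht
  rw [le_div_iff₀ (by positivity)] at h1
  set X := derivWithin (fun s => (γ s).1) (Icc 0 1) t
  have h2 : h * X ≤ w * |X| := (le_abs_self _).trans (by rw [abs_mul]; gcongr)
  linarith

/-- Wrinkling: an arbitrarily C⁰-small transverse isotopy of a positively
transverse arc, fixed near the endpoints, pushing the arc off a prescribed
interior point `p = γ t₀`. -/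
theorem wrinkling (γ : ℝ → ℝ × ℝ × ℝ) (hγ : IsTransverseArc γ)
    (t₀ : ℝ) (ht₀ : t₀ ∈ Ioo (0 : ℝ) 1) (p : ℝ × ℝ × ℝ) (hp : p = γ t₀)
    (ε : ℝ) (hε : 0 < ε) :
    ∃ (H : ℝ × ℝ → ℝ × ℝ × ℝ) (δ : ℝ), 0 < δ ∧
      ContDiffOn ℝ (⊤ : ℕ∞) H (Icc 0 1 ×ˢ Icc 0 1) ∧
      (∀ t ∈ Icc (0 : ℝ) 1, H (0, t) = γ t) ∧
      (∀ s ∈ Icc (0 : ℝ) 1, IsTransverseArc (fun t => H (s, t))) ∧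
      (∀ s ∈ Icc (0 : ℝ) 1, ∀ t ∈ Icc (0 : ℝ) 1,
        (t ≤ δ ∨ 1 - δ ≤ t) → H (s, t) = γ t) ∧
      (∀ s ∈ Icc (0 : ℝ) 1, ∀ t ∈ Icc (0 : ℝ) 1, ‖H (s, t) - γ t‖ < ε) ∧
      p ∉ (fun t => H (1, t)) '' Icc 0 1 := by
  obtain ⟨r, hr, hr0, hr1, hloc⟩ := hγ.exists_injOn_ball ht₀
  obtain ⟨w, hw, hwt⟩ := hγ.exists_pos_mul_lt
  obtain ⟨hsm, hinj, -, -⟩ := hγ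
  obtain ⟨m, hm, hmt⟩ := exists_pos_le_norm_sub hsm.continuousOn hinj t₀ hr
  obtain ⟨c, hc, hc'⟩ := exists_between (lt_min hε (lt_min hm hw))
  obtain ⟨hcε, hcm, hcw⟩ : c < ε ∧ c < m ∧ c < w := by simpa using hc'
  let χ : ContDiffBump t₀ := ⟨r / 4, r / 2, by linarith, by linarith⟩
  have hχ0 : ∀ t, t ∉ Metric.ball t₀ (r / 2) → χ t = 0 := fun t ht =>
    χ.zero_of_le_dist (by simpa using ht)
  have hχt : χ t₀ = 1 := χ.one_of_mem_closedBall (by simpa using χ.rIn_pos.le)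
  have hbound : ∀ s ∈ Icc (0 : ℝ) 1, ∀ t, 0 ≤ s * (c * χ t) ∧ s * (c * χ t) ≤ c := by
    intro s hs t
    have h0 : 0 ≤ c * χ t := mul_nonneg hc.le χ.nonneg
    have h1 : c * χ t ≤ c := mul_le_of_le_one_right hc.le χ.le_one
    exact ⟨mul_nonneg hs.1 h0, (mul_le_of_le_one_left h0 hs.2).trans h1⟩
  have hsmooth : ∀ s : ℝ, ContDiffOn ℝ (⊤ : ℕ∞)
      (fun t => ((γ t).1, (γ t).2.1 + s * (c * χ t), (γ t).2.2)) (Icc 0 1) := fun s =>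
    hsm.fst.prodMk ((hsm.snd.fst.add
      (contDiff_const.mul (contDiff_const.mul χ.contDiff)).contDiffOn).prodMk hsm.snd.snd)
  have hsep : ∀ s ∈ Icc (0 : ℝ) 1, ∀ a ∈ Icc (0 : ℝ) 1, ∀ b ∈ Icc (0 : ℝ) 1,
      (γ a).1 = (γ b).1 → (γ a).2.1 + s * (c * χ a) = (γ b).2.1 + s * (c * χ b) →
      (γ a).2.2 = (γ b).2.2 → b ∉ Metric.ball t₀ r → a = b := by
    intro s hs a ha b hb hx hy hz hbr
    have hb0 : χ b = 0 := hχ0 b fun h => hbr (Metric.ball_subset_ball (by linarith) h)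
    rw [hb0, mul_zero, mul_zero, add_zero] at hy
    by_cases har : a ∈ Metric.ball t₀ (r / 2)
    · have hle := hmt a ha b hb (Metric.ball_subset_closedBall har) hbr
      have heq : γ a - γ b = (0, -(s * (c * χ a)), 0) :=
        Prod.ext (by simp [hx]) (Prod.ext (by simp [← hy]) (by simp [hz]))
      obtain ⟨h0, h1⟩ := hbound s hs a
      have hnorm : ‖γ a - γ b‖ ≤ c := by
        rw [heq]
        rw [Prod.norm_mk, Prod.norm_mk, norm_zero, norm_neg, Real.norm_of_nonneg h0,
          max_eq_left h0, max_eq_right h0]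
        exact h1
      linarith
    · rw [hχ0 a har, mul_zero, mul_zero, add_zero] at hy
      exact hinj ha hb (Prod.ext hx (Prod.ext hy hz))
  refine ⟨fun q => ((γ q.2).1, (γ q.2).2.1 + q.1 * (c * χ q.2), (γ q.2).2.2), r / 2,
    by linarith, ?_, ?_, ?_, ?_, ?_, ?_⟩
  · have hγ2 : ContDiffOn ℝ (⊤ : ℕ∞) (fun q : ℝ × ℝ => γ q.2) (Icc 0 1 ×ˢ Icc 0 1) :=
      hsm.comp contDiffOn_snd fun _ hq => hq.2
    exact hγ2.fst.prodMk ((hγ2.snd.fst.add (contDiff_fst.mul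
      (contDiff_const.mul (χ.contDiff.comp contDiff_snd))).contDiffOn).prodMk hγ2.snd.snd)
  · intro t _
    simp
  · intro s hs
    have htr : ∀ t ∈ Icc (0 : ℝ) 1, derivWithin (fun s => (γ s).2.2) (Icc 0 1) t
        - ((γ t).2.1 + s * (c * χ t)) * derivWithin (fun s => (γ s).1) (Icc 0 1) t > 0 := by
      intro t ht
      obtain ⟨h0, h1⟩ := hbound s hs t
      exact hwt t ht _ (by rw [abs_of_nonneg h0]; linarith)
    refine ⟨hsmooth s, ?_, fun t ht => derivWithin_ne_zero_of_transverse (hsmooth s) ht (htr t ht),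
      htr⟩
    intro a ha b hb hab
    simp only [Prod.mk.injEq] at hab
    obtain ⟨hx, hy, hz⟩ := hab
    by_cases hbr : b ∈ Metric.ball t₀ r
    · by_cases har : a ∈ Metric.ball t₀ r
      · exact hloc har hbr (by simp only [hx, hz])
      · exact (hsep s hs b hb a ha hx.symm hy.symm hz.symm har).symm
    · exact hsep s hs a ha b hb hx hy hz hbr
  · intro s _ t _ htδ
    have h0 : χ t = 0 := hχ0 t fun h => by
      rw [Real.ball_eq_Ioo] at h
      rcases htδ with h' | h'
      · linarith [h.1]
      · linarith [h.2]
    simp [h0]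
  · intro s hs t _
    obtain ⟨h0, h1⟩ := hbound s hs t
    have heq : ((γ t).1, (γ t).2.1 + s * (c * χ t), (γ t).2.2) - γ t = (0, s * (c * χ t), 0) :=
      Prod.ext (by simp) (Prod.ext (by simp) (by simp))
    have hnorm : ‖((0 : ℝ), s * (c * χ t), (0 : ℝ))‖ = s * (c * χ t) := by
      rw [Prod.norm_mk, Prod.norm_mk, norm_zero, Real.norm_of_nonneg h0, max_eq_left h0,
        max_eq_right h0]
    simp only [heq, hnorm]
    linarith
  · rintro ⟨t, ht, htp⟩
    simp only [hp, Prod.ext_iff, one_mul] at htp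
    obtain ⟨hx, hy, hz⟩ := htp
    have ht₀r : t₀ ∈ Metric.ball t₀ r := Metric.mem_ball_self hr
    have htr : t ∈ Metric.ball t₀ r := by
      by_contra htr
      have h0 : χ t = 0 := hχ0 t fun h => htr (Metric.ball_subset_ball (by linarith) h)
      rw [h0, mul_zero, add_zero] at hy
      exact htr (hinj ht (Ioo_subset_Icc_self ht₀) (Prod.ext hx (Prod.ext hy hz)) ▸ ht₀r)
    obtain rfl : t = t₀ := hloc htr ht₀r (by simp only [hx, hz])
    rw [hχt] at hy
    linarith
end

section
/- Every smooth link in ℝ³ is smoothly isotopic, through smooth links, to a link braided about the z-axis. Precisely: let n ≥ 1 and let L : Fin n × 𝕊¹ → ℝ³ be a smooth link. Then there exists a smooth map H : ℝ × (Fin n × 𝕊¹) → ℝ³ such that H(0,·) = L, the map H(s,·) is a smooth link for every s ∈ [0,1], and H(1,·) is braided about the z-axis. -/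
/-!
Topological braiding (Corollary 1.3 in the model case): every smooth link in ℝ³
is smoothly isotopic, through smooth links, to a link braided about the z-axis.

We model ℝ³ as `ℝ × ℝ × ℝ` with coordinates `(x, y, z)` and the circle
`𝕊¹ = {v ∈ ℝ² : ‖v‖ = 1}` as Mathlib's `Circle` (the unit sphere in ℂ ≅ ℝ²).
-/

/-- The `i`-th component loop of `L`, parametrized by angle. -/
noncomputable def componentLoop {n : ℕ} (L : Fin n × Circle → ℝ × ℝ × ℝ)
    (i : Fin n) (t : ℝ) : ℝ × ℝ × ℝ :=
  L (i, Circle.exp t)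

/-- `L : Fin n × 𝕊¹ → ℝ³` is a smooth link: a smooth injective immersion. -/
noncomputable def IsSmoothLink {n : ℕ} (L : Fin n × Circle → ℝ × ℝ × ℝ) : Prop :=
  Function.Injective L ∧
  ∀ i : Fin n, ContDiff ℝ (⊤ : ℕ∞) (componentLoop L i) ∧
    ∀ t : ℝ, deriv (componentLoop L i) t ≠ 0

/-- `L = (x, y, z)` is braided about the z-axis: its image misses the z-axis and
`x * y' - y * x' > 0` everywhere. -/
noncomputable def IsBraided {n : ℕ} (L : Fin n × Circle → ℝ × ℝ × ℝ) : Prop :=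
  (∀ (i : Fin n) (t : ℝ), ((componentLoop L i t).1, (componentLoop L i t).2.1) ≠ (0, 0)) ∧
  ∀ (i : Fin n) (t : ℝ),
    (componentLoop L i t).1 * deriv (fun s => (componentLoop L i s).2.1) t
      - (componentLoop L i t).2.1 * deriv (fun s => (componentLoop L i s).1) t > 0

namespace LinkBraiding

open Set Filter Topology MeasureTheory
open scoped ContDiff Convolution Real

section Mollify

variable {E : Type*} [NormedAddCommGroup E] [NormedSpace ℝ E]

/-- The convolution of `g` with the normalized bump function `φ`. -/
noncomputable def mollify (φ : ContDiffBump (0 : ℝ)) (g : ℝ → E) : ℝ → E :=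
  φ.normed volume ⋆[ContinuousLinearMap.lsmul ℝ ℝ, volume] g

/-- `g` has slope at least `c` in the direction `ℓ` on the interval of radius `r` around `x`. -/
def MonoNear (ℓ : E →L[ℝ] ℝ) (g : ℝ → E) (c x r : ℝ) : Prop :=
  ∀ t u, x - r ≤ t → t ≤ u → u ≤ x + r → c * (u - t) ≤ ℓ (g u - g t)

theorem mollify_apply (φ : ContDiffBump (0 : ℝ)) (g : ℝ → E) (t : ℝ) :
    mollify φ g t = ∫ v, φ.normed volume v • g (t - v) := rfl

theorem integrable_bump_smul (φ : ContDiffBump (0 : ℝ)) {h : ℝ → E} (hh : Continuous h) :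
    Integrable fun v => φ.normed volume v • h v :=
  (φ.continuous_normed.smul hh).integrable_of_hasCompactSupport
    φ.hasCompactSupport_normed.smul_right

theorem mollify_contDiff (φ : ContDiffBump (0 : ℝ)) {g : ℝ → E} (hg : Continuous g) :
    ContDiff ℝ ∞ (mollify φ g) :=
  φ.hasCompactSupport_normed.contDiff_convolution_left _ φ.contDiff_normed
    hg.locallyIntegrable

theorem mollify_periodic (φ : ContDiffBump (0 : ℝ)) {g : ℝ → E} {T : ℝ}
    (hg : Function.Periodic g T) : Function.Periodic (mollify φ g) T := by
  intro t
  simp only [mollify_apply]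
  congr 1
  ext v
  rw [show t + T - v = t - v + T by ring, hg]

theorem mollify_add_smul (φ : ContDiffBump (0 : ℝ)) {g h : ℝ → E} (hg : Continuous g)
    (hh : Continuous h) (s : ℝ) (t : ℝ) :
    mollify φ (fun u => g u + s • h u) t = mollify φ g t + s • mollify φ h t := by
  simp only [mollify_apply]
  rw [← integral_smul, ← integral_add]
  · congr 1
    ext v
    rw [smul_add, smul_comm]
  · exact integrable_bump_smul φ (hg.comp (continuous_const.sub continuous_id))
  · exact (integrable_bump_smul φ (hh.comp (continuous_const.sub continuous_id))).smul s

theorem norm_mollify_sub_le [CompleteSpace E] (φ : ContDiffBump (0 : ℝ)) {g : ℝ → E} {K : NNReal}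
    (hg : LipschitzWith K g) (t : ℝ) : ‖mollify φ g t - g t‖ ≤ K * φ.rOut := by
  rw [← dist_eq_norm]
  refine φ.dist_normed_convolution_le hg.continuous.aestronglyMeasurable fun x hx => ?_
  exact (hg.dist_le_mul x t).trans (by gcongr; exact (Metric.mem_ball.1 hx).le)

theorem mollify_sub (φ : ContDiffBump (0 : ℝ)) {g : ℝ → E} (hg : Continuous g) (t u : ℝ) :
    mollify φ g u - mollify φ g t = ∫ v, φ.normed volume v • (g (u - v) - g (t - v)) := by
  simp only [mollify_apply]
  rw [← integral_sub]
  · simp only [smul_sub]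
  · exact integrable_bump_smul φ (hg.comp (continuous_const.sub continuous_id))
  · exact integrable_bump_smul φ (hg.comp (continuous_const.sub continuous_id))

theorem mollify_lipschitz (φ : ContDiffBump (0 : ℝ)) {g : ℝ → E} {K : NNReal}
    (hg : LipschitzWith K g) : LipschitzWith K (mollify φ g) := by
  refine LipschitzWith.of_dist_le_mul fun u t => ?_
  rw [dist_eq_norm, mollify_sub φ hg.continuous]
  calc ‖∫ v, φ.normed volume v • (g (u - v) - g (t - v))‖
      ≤ ∫ v, φ.normed volume v * (K * dist u t) := by
        refine norm_integral_le_of_norm_le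
          ((φ.integrable_normed (μ := volume)).mul_const _) (Eventually.of_forall fun v => ?_)
        rw [norm_smul, Real.norm_of_nonneg (φ.nonneg_normed v), ← dist_eq_norm]
        have := hg.dist_le_mul (u - v) (t - v)
        rw [dist_sub_right] at this
        exact mul_le_mul_of_nonneg_left this (φ.nonneg_normed v)
    _ = K * dist u t := by
        rw [integral_mul_const, φ.integral_normed, one_mul]

theorem MonoNear.mono {ℓ : E →L[ℝ] ℝ} {g : ℝ → E} {c c' x x' r r' : ℝ} (h : MonoNear ℓ g c x r)
    (hc : c' ≤ c) (hr : |x' - x| + r' ≤ r) : MonoNear ℓ g c' x' r' := by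
  intro t u h1 h2 h3
  have h4 := abs_le.1 (le_refl |x' - x|)
  refine le_trans ?_ (h t u (by linarith) h2 (by linarith))
  exact mul_le_mul_of_nonneg_right hc (by linarith)

theorem MonoNear.mollify [CompleteSpace E] {ℓ : E →L[ℝ] ℝ} {g : ℝ → E} {c x r r' : ℝ}
    (h : MonoNear ℓ g c x r) (hg : Continuous g) (φ : ContDiffBump (0 : ℝ))
    (hφ : r' + φ.rOut ≤ r) : MonoNear ℓ (mollify φ g) c x r' := by
  intro t u h1 h2 h3
  have hi : Integrable fun v => φ.normed volume v • (g (u - v) - g (t - v)) :=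
    integrable_bump_smul φ ((hg.comp (continuous_const.sub continuous_id)).sub
      (hg.comp (continuous_const.sub continuous_id)))
  rw [mollify_sub φ hg, ← ℓ.integral_comp_comm hi]
  calc c * (u - t) = ∫ v, φ.normed volume v * (c * (u - t)) := by
        rw [integral_mul_const, φ.integral_normed, one_mul]
    _ ≤ _ := by
        refine integral_mono ((φ.integrable_normed (μ := volume)).mul_const _)
          (ℓ.integrable_comp hi) fun v => ?_
        simp only [map_smul, smul_eq_mul]
        by_cases hv : v ∈ Metric.ball (0 : ℝ) φ.rOut
        · rw [mem_ball_zero_iff, Real.norm_eq_abs] at hv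
          have h4 := abs_lt.1 hv
          have := h (t - v) (u - v) (by linarith) (by linarith) (by linarith)
          rw [sub_sub_sub_cancel_right] at this
          exact mul_le_mul_of_nonneg_left this (φ.nonneg_normed v)
        · have : φ.normed volume v = 0 := by
            rw [← Function.notMem_support, φ.support_normed_eq]
            exact hv
          simp [this]

theorem MonoNear.le_deriv {ℓ : E →L[ℝ] ℝ} {g : ℝ → E} {c x r : ℝ} (h : MonoNear ℓ g c x r)
    {t : ℝ} (ht : |t - x| < r) (hg : DifferentiableAt ℝ g t) : c ≤ ℓ (deriv g t) := by
  have hd : HasDerivAt (fun s => ℓ (g s)) (ℓ (deriv g t)) t :=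
    ℓ.hasFDerivAt.comp_hasDerivAt t hg.hasDerivAt
  have hs := hasDerivAt_iff_tendsto_slope.1 hd
  have hs' : Tendsto (slope (fun s => ℓ (g s)) t) (𝓝[>] t) (𝓝 (ℓ (deriv g t))) :=
    hs.mono_left (nhdsWithin_mono _ fun y hy => ne_of_gt hy)
  refine ge_of_tendsto hs' ?_
  have h1 := abs_lt.1 ht
  have h2 : ∀ᶠ y in 𝓝[>] t, y < x + r :=
    nhdsWithin_le_nhds (Iio_mem_nhds (by linarith))
  filter_upwards [h2, self_mem_nhdsWithin] with y hy hy'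
  have hy'' : t < y := hy'
  rw [slope_def_field, le_div_iff₀ (by linarith), ← map_sub]
  exact h t y (by linarith) hy''.le hy.le

theorem MonoNear.add_smul {ℓ : E →L[ℝ] ℝ} {g h : ℝ → E} {c c' x r s : ℝ} {K : NNReal}
    (hm : MonoNear ℓ g c x r) (hh : LipschitzWith K h) (hc : c' + |s| * K * ‖ℓ‖ ≤ c) :
    MonoNear ℓ (fun t => g t + s • h t) c' x r := by
  intro t u h1 h2 h3
  have h4 := hm t u h1 h2 h3
  have h5 : |ℓ (h u - h t)| ≤ ‖ℓ‖ * (K * (u - t)) := by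
    refine (ℓ.le_opNorm _).trans ?_
    gcongr
    have := hh.norm_sub_le u t
    rwa [Real.norm_of_nonneg (sub_nonneg.2 h2)] at this
  have h6 : ℓ (g u + s • h u - (g t + s • h t)) = ℓ (g u - g t) + s * ℓ (h u - h t) := by
    simp only [map_sub, map_add, map_smul, smul_eq_mul]; ring
  rw [h6]
  have h7 : |s * ℓ (h u - h t)| ≤ |s| * (‖ℓ‖ * (K * (u - t))) := by
    rw [abs_mul]; gcongr
  have h8 := (abs_le.1 h7).1
  have h9 := mul_le_mul_of_nonneg_right hc (sub_nonneg.2 h2)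
  nlinarith

theorem MonoNear.combination {ℓ : E →L[ℝ] ℝ} {g h : ℝ → E} {c x r s : ℝ}
    (hg : MonoNear ℓ g c x r) (hh : MonoNear ℓ h c x r) (h0 : 0 ≤ s) (h1 : s ≤ 1) :
    MonoNear ℓ (fun t => g t + s • (h t - g t)) c x r := by
  intro t u h2 h3 h4
  have h5 := hg t u h2 h3 h4
  have h6 := hh t u h2 h3 h4
  have h7 : ℓ (g u + s • (h u - g u) - (g t + s • (h t - g t)))
      = (1 - s) * ℓ (g u - g t) + s * ℓ (h u - h t) := by
    simp only [map_sub, map_add, map_smul, smul_eq_mul]; ring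
  rw [h7]
  nlinarith [mul_le_mul_of_nonneg_left h5 (sub_nonneg.2 h1), mul_le_mul_of_nonneg_left h6 h0]

theorem MonoNear.eq_of_eq {ℓ : E →L[ℝ] ℝ} {g : ℝ → E} {c x r : ℝ} (h : MonoNear ℓ g c x r)
    (hc : 0 < c) {t u : ℝ} (ht : |t - x| ≤ r) (hu : |u - x| ≤ r) (heq : g t = g u) : t = u := by
  have h1 := abs_le.1 ht
  have h2 := abs_le.1 hu
  rcases le_total t u with h3 | h3
  · have := h t u (by linarith) h3 (by linarith)
    rw [heq, sub_self, map_zero] at this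
    nlinarith
  · have := h u t (by linarith) h3 (by linarith)
    rw [heq, sub_self, map_zero] at this
    nlinarith

end Mollify

section Links

variable {ι E : Type*} [NormedAddCommGroup E] [NormedSpace ℝ E]

/-- Injectivity of a family of loops of period one. -/
def InjMod (f : ι → ℝ → E) : Prop :=
  ∀ i j t u, f i t = f j u → i = j ∧ ∃ k : ℤ, t = u + k

/-- A smooth link, given by loops of period one. -/
structure IsLoopLink (f : ι → ℝ → E) : Prop where
  periodic : ∀ i, Function.Periodic (f i) 1
  smooth : ∀ i, ContDiff ℝ ∞ (f i)
  deriv_ne : ∀ i t, deriv (f i) t ≠ 0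
  inj : InjMod f

/-- A Lipschitz link which is locally strictly monotone in some direction. -/
structure Tame (f : ι → ℝ → E) : Prop where
  periodic : ∀ i, Function.Periodic (f i) 1
  lipschitz : ∃ K, ∀ i, LipschitzWith K (f i)
  inj : InjMod f
  mono : ∀ i x, ∃ (ℓ : E →L[ℝ] ℝ) (c r : ℝ), 0 < c ∧ 0 < r ∧ MonoNear ℓ (f i) c x r

/-- Smooth isotopy through links, stationary outside the time interval `[0, 1]`. -/
def Isotopic (f g : ι → ℝ → E) : Prop :=
  ∃ H : ℝ → ι → ℝ → E, (∀ i, ContDiff ℝ ∞ fun p : ℝ × ℝ => H p.1 i p.2) ∧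
    (∀ s ≤ 0, H s = f) ∧ (∀ s, 1 ≤ s → H s = g) ∧ ∀ s, IsLoopLink (H s)

theorem Isotopic.trans {f g h : ι → ℝ → E} (h1 : Isotopic f g) (h2 : Isotopic g h) :
    Isotopic f h := by
  obtain ⟨H, hH, hH0, hH1, hHl⟩ := h1
  obtain ⟨J, hJ, hJ0, hJ1, hJl⟩ := h2
  have hg : IsLoopLink g := hH1 1 le_rfl ▸ hHl 1
  have key1 : ∀ s ≤ 1 / 2, (fun i t => H (2 * s) i t + J (2 * s - 1) i t - g i t) = H (2 * s) := by
    intro s hs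
    rw [hJ0 (2 * s - 1) (by linarith)]
    simp
  have key2 : ∀ s, 1 / 2 ≤ s →
      (fun i t => H (2 * s) i t + J (2 * s - 1) i t - g i t) = J (2 * s - 1) := by
    intro s hs
    rw [hH1 (2 * s) (by linarith)]
    simp
  refine ⟨fun s i t => H (2 * s) i t + J (2 * s - 1) i t - g i t, fun i => ?_, fun s hs => ?_,
    fun s hs => ?_, fun s => ?_⟩
  · have e1 : ContDiff ℝ ∞ fun p : ℝ × ℝ => H (2 * p.1) i p.2 :=
      (hH i).comp ((contDiff_const.mul contDiff_fst).prodMk contDiff_snd)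
    have e2 : ContDiff ℝ ∞ fun p : ℝ × ℝ => J (2 * p.1 - 1) i p.2 :=
      (hJ i).comp (((contDiff_const.mul contDiff_fst).sub contDiff_const).prodMk contDiff_snd)
    exact (e1.add e2).sub ((hg.smooth i).comp contDiff_snd)
  · exact (key1 s (by linarith)).trans (hH0 _ (by linarith))
  · exact (key2 s (by linarith)).trans (hJ1 _ (by linarith))
  · rcases le_total s (1 / 2) with hs | hs
    · change IsLoopLink fun i t => H (2 * s) i t + J (2 * s - 1) i t - g i t
      rw [key1 s hs]
      exact hHl _
    · change IsLoopLink fun i t => H (2 * s) i t + J (2 * s - 1) i t - g i t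
      rw [key2 s hs]
      exact hJl _

theorem Isotopic.of_segment {f h : ι → ℝ → E} (hf : ∀ i, ContDiff ℝ ∞ (f i))
    (hh : ∀ i, ContDiff ℝ ∞ (h i))
    (hl : ∀ s ∈ Icc (0 : ℝ) 1, IsLoopLink fun i t => f i t + s • h i t) :
    Isotopic f fun i t => f i t + h i t := by
  refine ⟨fun s i t => f i t + Real.smoothTransition s • h i t, fun i => ?_, fun s hs => ?_,
    fun s hs => ?_, fun s => ?_⟩
  · exact ((hf i).comp contDiff_snd).add
      ((Real.smoothTransition.contDiff.comp contDiff_fst).smul ((hh i).comp contDiff_snd))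
  · simp [Real.smoothTransition.zero_of_nonpos hs]
  · simp [Real.smoothTransition.one_of_one_le hs]
  · exact hl _ ⟨Real.smoothTransition.nonneg _, Real.smoothTransition.le_one _⟩

theorem InjMod.of_near_far {f : ι → ℝ → E} {r : ℝ} (per : ∀ i, Function.Periodic (f i) 1)
    (near : ∀ i t u, |t - u| < r → f i t = f i u → t = u)
    (far : ∀ i j, ∀ t ∈ Icc (0 : ℝ) 1, ∀ u, |t - u| ≤ 1 / 2 → (i = j → r ≤ |t - u|) →
      f i t ≠ f j u) : InjMod f := by
  intro i j t u h
  set t' := t - ⌊t⌋ with ht'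
  set u' := u - round (u - t') with hu'
  have h1 : f i t' = f i t := by
    have := (per i).sub_int_mul_eq ⌊t⌋ (x := t)
    rwa [mul_one] at this
  have h2 : f j u' = f j u := by
    have := (per j).sub_int_mul_eq (round (u - t')) (x := u)
    rwa [mul_one] at this
  have h3 : |t' - u'| ≤ 1 / 2 := by
    have := abs_sub_round (u - t')
    have e : u' - t' = u - t' - round (u - t') := by rw [hu']; ring
    rwa [abs_sub_comm, e]
  have h4 : t' ∈ Icc (0 : ℝ) 1 := ⟨Int.fract_nonneg t, (Int.fract_lt_one t).le⟩
  have h5 : f i t' = f j u' := by rw [h1, h2, h]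
  by_cases h6 : i = j ∧ |t' - u'| < r
  · obtain ⟨rfl, h7⟩ := h6
    refine ⟨rfl, ⌊t⌋ - round (u - t'), ?_⟩
    have := near i t' u' h7 h5
    push_cast
    linarith
  · refine absurd h5 (far i j t' h4 u' h3 fun hij => ?_)
    by_contra hlt
    exact h6 ⟨hij, not_le.1 hlt⟩

theorem MonoNear.of_periodic {ℓ : E →L[ℝ] ℝ} {g : ℝ → E} {c x r : ℝ}
    (hg : Function.Periodic g 1) (k : ℤ) (h : MonoNear ℓ g c (x - k) r) : MonoNear ℓ g c x r := by
  intro t u h1 h2 h3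
  have := h (t - k) (u - k) (by linarith) (by linarith) (by linarith)
  have e : ∀ y, g (y - k) = g y := fun y => by simpa using hg.sub_int_mul_eq k (x := y)
  rwa [e, e, sub_sub_sub_cancel_right] at this

theorem MonoNear.normalize {ℓ : E →L[ℝ] ℝ} {g : ℝ → E} {c x r : ℝ} (hc : 0 < c)
    (h : MonoNear ℓ g c x r) :
    ∃ ℓ' : E →L[ℝ] ℝ, ‖ℓ'‖ ≤ 1 ∧ ∃ c' > 0, MonoNear ℓ' g c' x r := by
  have hp : 0 < ‖ℓ‖ + 1 := by positivity
  refine ⟨(‖ℓ‖ + 1)⁻¹ • ℓ, ?_, (‖ℓ‖ + 1)⁻¹ * c, by positivity, fun t u h1 h2 h3 => ?_⟩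
  · rw [norm_smul, norm_inv, Real.norm_of_nonneg hp.le, inv_mul_le_iff₀ hp]
    linarith
  · rw [_root_.smul_apply, smul_eq_mul, mul_assoc]
    exact mul_le_mul_of_nonneg_left (h t u h1 h2 h3) (by positivity)

/-- Along a segment of tame links, the tameness constants can be chosen uniformly. -/
theorem exists_uniform_tame [Finite ι] {f h : ι → ℝ → E} {K : NNReal}
    (hh : ∀ i, LipschitzWith K (h i))
    (ht : ∀ s ∈ Icc (0 : ℝ) 1, Tame fun i t => f i t + s • h i t) :
    ∃ r > 0, (∀ s ∈ Icc (0 : ℝ) 1, ∀ i x, ∃ ℓ : E →L[ℝ] ℝ, ‖ℓ‖ ≤ 1 ∧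
        MonoNear ℓ (fun t => f i t + s • h i t) r x r) ∧
      ∃ m > 0, ∀ s ∈ Icc (0 : ℝ) 1, ∀ i j, ∀ t ∈ Icc (0 : ℝ) 1, ∀ u, |t - u| ≤ 1 / 2 →
        (i = j → r / 2 ≤ |t - u|) → m ≤ ‖(f i t + s • h i t) - (f j u + s • h j u)‖ := by
  have near : ∀ i, ∀ᶠ r : ℝ in 𝓝 0, ∀ p ∈ Icc (0 : ℝ) 1 ×ˢ Icc (0 : ℝ) 1, 0 < r →
      ∃ ℓ : E →L[ℝ] ℝ, ‖ℓ‖ ≤ 1 ∧ MonoNear ℓ (fun t => f i t + p.1 • h i t) r p.2 r := by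
    intro i
    refine (isCompact_Icc.prod isCompact_Icc).eventually_forall_of_forall_eventually ?_
    rintro ⟨s₀, x₀⟩ ⟨hs₀, -⟩
    obtain ⟨ℓ₀, c₀, r₀, hc₀, hr₀, hm₀⟩ := (ht s₀ hs₀).mono i x₀
    obtain ⟨ℓ, hℓ, c, hc, hm⟩ := hm₀.normalize hc₀
    have e1 : ∀ᶠ z : ℝ × ℝ × ℝ in 𝓝 (0, s₀, x₀), z.1 + |z.2.1 - s₀| * K < c := by
      refine ContinuousAt.eventually_lt (by fun_prop) continuousAt_const ?_
      simpa using hc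
    have e2 : ∀ᶠ z : ℝ × ℝ × ℝ in 𝓝 (0, s₀, x₀), |z.2.2 - x₀| + z.1 < r₀ := by
      refine ContinuousAt.eventually_lt (by fun_prop) continuousAt_const ?_
      simpa using hr₀
    filter_upwards [e1, e2] with z h1 h2 hz
    refine ⟨ℓ, hℓ, ?_⟩
    have h3 := (hm.mono le_rfl h2.le).add_smul (hh i) (c' := z.1) (s := z.2.1 - s₀) (by
      have : |z.2.1 - s₀| * K * ‖ℓ‖ ≤ |z.2.1 - s₀| * K :=
        mul_le_of_le_one_right (by positivity) hℓ
      linarith)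
    convert h3 using 2 with t
    rw [sub_smul]; abel
  obtain ⟨r, hr, hr0⟩ := (((eventually_all.2 near).filter_mono
    (nhdsWithin_le_nhds (s := Ioi 0))).and self_mem_nhdsWithin).exists
  have hr0' : 0 < r := hr0
  refine ⟨r, hr0', fun s hs i x => ?_, ?_⟩
  · obtain ⟨ℓ, hℓ, hm⟩ := hr i (s, x - ⌊x⌋)
      ⟨hs, ⟨Int.fract_nonneg x, (Int.fract_lt_one x).le⟩⟩ hr0'
    exact ⟨ℓ, hℓ, hm.of_periodic ((ht s hs).periodic i)⟩
  have hcont : ∀ s ∈ Icc (0 : ℝ) 1, ∀ i, Continuous fun t => f i t + s • h i t := fun s hs i =>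
    ((ht s hs).lipschitz.choose_spec i).continuous
  have hf : ∀ i, Continuous (f i) := fun i => by simpa using hcont 0 (by simp) i
  have far : ∀ i j, ∃ m > 0, ∀ p ∈ {p : ℝ × ℝ × ℝ | p.1 ∈ Icc (0 : ℝ) 1 ∧ p.2.1 ∈ Icc (0 : ℝ) 1 ∧
      |p.2.1 - p.2.2| ≤ 1 / 2 ∧ (i = j → r / 2 ≤ |p.2.1 - p.2.2|)},
      m ≤ ‖(f i p.2.1 + p.1 • h i p.2.1) - (f j p.2.2 + p.1 • h j p.2.2)‖ := by
    intro i j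
    refine IsCompact.exists_forall_le' ?_ ?_ ?_
    · refine ((isCompact_Icc (a := (0 : ℝ)) (b := 1)).prod
        ((isCompact_Icc (a := (0 : ℝ)) (b := 1)).prod
          (isCompact_Icc (a := (-1 : ℝ)) (b := 2)))).of_isClosed_subset ?_ ?_
      · have c1 : IsClosed {p : ℝ × ℝ × ℝ | p.1 ∈ Icc (0 : ℝ) 1} :=
          isClosed_Icc.preimage continuous_fst
        have c2 : IsClosed {p : ℝ × ℝ × ℝ | p.2.1 ∈ Icc (0 : ℝ) 1} :=
          isClosed_Icc.preimage (continuous_fst.comp continuous_snd)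
        have c3 : IsClosed {p : ℝ × ℝ × ℝ | |p.2.1 - p.2.2| ≤ 1 / 2} :=
          isClosed_le (by fun_prop) continuous_const
        have c4 : IsClosed {p : ℝ × ℝ × ℝ | i = j → r / 2 ≤ |p.2.1 - p.2.2|} := by
          by_cases hij : i = j
          · simpa [hij] using isClosed_le (f := fun _ : ℝ × ℝ × ℝ => r / 2)
              (g := fun p => |p.2.1 - p.2.2|) continuous_const (by fun_prop)
          · simp [hij]
        exact c1.inter (c2.inter (c3.inter c4))
      · rintro ⟨s, t, u⟩ ⟨h1, h2, h3, -⟩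
        have := abs_le.1 h3
        exact ⟨h1, h2, by have := h2.1; constructor <;> linarith [h2.1, h2.2]⟩
    · have := hf i
      have := hf j
      have := (hh i).continuous
      have := (hh j).continuous
      fun_prop
    · rintro ⟨s, t, u⟩ ⟨h1, h2, h3, h4⟩
      rw [norm_pos_iff, sub_ne_zero]
      intro heq
      obtain ⟨hij, k, hk⟩ := (ht s h1).inj i j t u heq
      have h5 := h4 hij
      simp only at h3 h5 hk
      rw [hk, add_sub_cancel_left] at h3 h5
      have hk0 : k = 0 := by
        have h6 : |(k : ℝ)| < 1 := by linarith
        exact_mod_cast Int.abs_lt_one_iff.1 (by exact_mod_cast h6)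
      simp [hk0] at h5
      linarith
  have : ∀ i j, ∀ᶠ m in 𝓝[>] (0 : ℝ), ∀ p ∈ {p : ℝ × ℝ × ℝ | p.1 ∈ Icc (0 : ℝ) 1 ∧
      p.2.1 ∈ Icc (0 : ℝ) 1 ∧ |p.2.1 - p.2.2| ≤ 1 / 2 ∧ (i = j → r / 2 ≤ |p.2.1 - p.2.2|)},
      m ≤ ‖(f i p.2.1 + p.1 • h i p.2.1) - (f j p.2.2 + p.1 • h j p.2.2)‖ := by
    intro i j
    obtain ⟨m, hm, hm'⟩ := far i j
    filter_upwards [nhdsWithin_le_nhds (Iio_mem_nhds hm)] with m' hmm p hp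
    exact (le_of_lt hmm).trans (hm' p hp)
  obtain ⟨m, hm, hm0⟩ := ((eventually_all.2 fun i => eventually_all.2 (this i)).and
    self_mem_nhdsWithin).exists
  exact ⟨m, hm0, fun s hs i j t ht' u h1 h2 => hm i j (s, t, u) ⟨hs, ht', h1, h2⟩⟩

/-- Tame links are stable under perturbations which are small in the Lipschitz sense. -/
theorem Tame.exists_perturb [Finite ι] {f : ι → ℝ → E} (hf : Tame f) :
    ∃ δ : NNReal, 0 < δ ∧ ∀ h : ι → ℝ → E, (∀ i, Function.Periodic (h i) 1) →
      (∀ i, LipschitzWith δ (h i)) → (∀ i t, ‖h i t‖ ≤ δ) → Tame fun i t => f i t + h i t := by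
  obtain ⟨r, hr, near, m, hm, far⟩ := exists_uniform_tame (f := f) (h := fun _ _ => 0) (K := 0)
    (fun i => LipschitzWith.const _) (fun s _ => by simpa using hf)
  simp only [smul_zero, add_zero] at near far
  have h0 : (0 : ℝ) ∈ Icc (0 : ℝ) 1 := by simp
  have hδ0 : 0 < min (r / 2) (m / 3) := lt_min (by positivity) (by positivity)
  refine ⟨(min (r / 2) (m / 3)).toNNReal, Real.toNNReal_pos.2 hδ0, ?_⟩
  intro h hper hlip hsup
  set δ : NNReal := (min (r / 2) (m / 3)).toNNReal with hδ
  have hδe : (δ : ℝ) = min (r / 2) (m / 3) := Real.coe_toNNReal _ hδ0.le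
  have hδr : (δ : ℝ) ≤ r / 2 := hδe.trans_le (min_le_left _ _)
  have hδm : (δ : ℝ) ≤ m / 3 := hδe.trans_le (min_le_right _ _)
  have near' : ∀ i x, ∃ ℓ : E →L[ℝ] ℝ, MonoNear ℓ (fun t => f i t + h i t) (r / 2) x r := by
    intro i x
    obtain ⟨ℓ, hℓ, hmono⟩ := near 0 h0 i x
    refine ⟨ℓ, ?_⟩
    have := hmono.add_smul (hlip i) (c' := r / 2) (s := 1) (by
      have : (δ : ℝ) * ‖ℓ‖ ≤ δ := mul_le_of_le_one_right (by positivity) hℓ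
      rw [abs_one, one_mul]
      linarith)
    simpa using this
  have per : ∀ i, Function.Periodic (fun t => f i t + h i t) 1 := fun i =>
    (hf.periodic i).add (hper i)
  refine ⟨per, ?_, ?_, fun i x => ?_⟩
  · obtain ⟨K, hK⟩ := hf.lipschitz
    exact ⟨K + δ, fun i => (hK i).add (hlip i)⟩
  · refine InjMod.of_near_far (r := r / 2) per (fun i t u htu heq => ?_) ?_
    · obtain ⟨ℓ, hmono⟩ := near' i t
      exact hmono.eq_of_eq (by positivity) (by simpa using hr.le)
        (by rw [abs_sub_comm]; linarith) heq
    · intro i j t ht u h1 h2 heq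
      have h3 := far 0 h0 i j t ht u h1 h2
      have h4 : f i t - f j u = h j u - h i t := by
        have : f i t + h i t = f j u + h j u := heq
        rw [sub_eq_sub_iff_add_eq_add, this, add_comm]
      rw [h4] at h3
      have h5 := norm_sub_le (h j u) (h i t)
      linarith [hsup j u, hsup i t]
  · obtain ⟨ℓ, hmono⟩ := near' i x
    exact ⟨ℓ, r / 2, r, by positivity, hr, hmono⟩

theorem IsLoopLink.of_mono {f : ι → ℝ → E} (hper : ∀ i, Function.Periodic (f i) 1)
    (hsm : ∀ i, ContDiff ℝ ∞ (f i)) (hinj : InjMod f)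
    (hm : ∀ i x, ∃ (ℓ : E →L[ℝ] ℝ) (c r : ℝ), 0 < c ∧ 0 < r ∧ MonoNear ℓ (f i) c x r) :
    IsLoopLink f := by
  refine ⟨hper, hsm, fun i t h0 => ?_, hinj⟩
  obtain ⟨ℓ, c, r, hc, hr, h⟩ := hm i t
  have := h.le_deriv (t := t) (by simpa using hr) ((hsm i).differentiable (by simp) t)
  rw [h0, map_zero] at this
  linarith

/-- Along a segment of tame links, sufficiently fine mollifications interpolate through
embeddings, uniformly in the segment. -/
theorem exists_mollify_segment [Finite ι] [CompleteSpace E] {f h : ι → ℝ → E} {K : NNReal}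
    (hh : ∀ i, LipschitzWith K (h i))
    (ht : ∀ s ∈ Icc (0 : ℝ) 1, Tame fun i t => f i t + s • h i t) :
    ∃ ε > 0, ∀ φ : ContDiffBump (0 : ℝ), φ.rOut < ε → ∀ s ∈ Icc (0 : ℝ) 1, ∀ σ ∈ Icc (0 : ℝ) 1,
      ∀ F : ι → ℝ → E, (F = fun i t => (f i t + s • h i t) +
        σ • (mollify φ (fun u => f i u + s • h i u) t - (f i t + s • h i t))) →
      (∀ i, ContDiff ℝ ∞ (F i)) → IsLoopLink F := by
  obtain ⟨r, hr, near, m, hm, far⟩ := exists_uniform_tame hh ht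
  obtain ⟨K', hK'⟩ := (ht 0 (by simp)).lipschitz
  have hlip : ∀ s ∈ Icc (0 : ℝ) 1, ∀ i, LipschitzWith (K' + K) fun t => f i t + s • h i t := by
    intro s hs i
    refine LipschitzWith.add (by simpa using hK' i) (LipschitzWith.of_dist_le_mul fun t u => ?_)
    rw [dist_smul₀, Real.norm_of_nonneg hs.1]
    have := (hh i).dist_le_mul t u
    exact (mul_le_of_le_one_left dist_nonneg hs.2).trans this
  set C : ℝ := K' + K with hC
  have hC0 : 0 ≤ C := by positivity
  refine ⟨min (r / 2) (m / (2 * (C + 1))), lt_min (by positivity) (by positivity), ?_⟩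
  intro φ hφ s hs σ hσ F hF hsm
  have hφr : φ.rOut < r / 2 := hφ.trans_le (min_le_left _ _)
  have hφm : φ.rOut < m / (2 * (C + 1)) := hφ.trans_le (min_le_right _ _)
  have per : ∀ i, Function.Periodic (F i) 1 := by
    intro i t
    have h1 := (ht s hs).periodic i
    have h2 := mollify_periodic φ h1 t
    have h3 := h1 t
    simp only at h3
    simp only [hF, h2, h3]
  have near' : ∀ i x, ∃ ℓ : E →L[ℝ] ℝ, MonoNear ℓ (F i) r x (r / 2) := by
    intro i x
    obtain ⟨ℓ, -, hmono⟩ := near s hs i x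
    refine ⟨ℓ, ?_⟩
    rw [hF]
    refine MonoNear.combination (hmono.mono le_rfl ?_) (hmono.mollify (hlip s hs i).continuous φ ?_)
      hσ.1 hσ.2
    · rw [sub_self, abs_zero]; linarith
    · linarith
  have close : ∀ i t, ‖F i t - (f i t + s • h i t)‖ < m / 2 := by
    intro i t
    have h1 := norm_mollify_sub_le φ (hlip s hs i) t
    rw [hF]
    simp only [add_sub_cancel_left, norm_smul, Real.norm_of_nonneg hσ.1]
    have h2 : C * φ.rOut < m / 2 := by
      rw [lt_div_iff₀ (by positivity)] at hφm
      nlinarith [φ.rOut_pos]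
    refine lt_of_le_of_lt (mul_le_of_le_one_left (norm_nonneg _) hσ.2) (lt_of_le_of_lt h1 ?_)
    simpa [hC] using h2
  refine IsLoopLink.of_mono per hsm ?_ fun i x => ?_
  · refine InjMod.of_near_far (r := r / 2) per (fun i t u htu heq => ?_) ?_
    · obtain ⟨ℓ, hmono⟩ := near' i t
      exact hmono.eq_of_eq hr (by rw [sub_self, abs_zero]; linarith)
        (by rw [abs_sub_comm]; exact htu.le) heq
    · intro i j t ht' u h1 h2 heq
      have h3 := far s hs i j t ht' u h1 h2
      have h4 := close i t
      have h5 := close j u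
      have h6 : (f i t + s • h i t) - (f j u + s • h j u)
          = (F j u - (f j u + s • h j u)) - (F i t - (f i t + s • h i t)) := by
        rw [heq]; abel
      rw [h6] at h3
      have h7 := norm_sub_le (F j u - (f j u + s • h j u)) (F i t - (f i t + s • h i t))
      linarith
  · obtain ⟨ℓ, hmono⟩ := near' i x
    exact ⟨ℓ, r, r / 2, hr, by positivity, hmono⟩

/-- Two tame links joined by a segment of tame links have isotopic mollifications. -/
theorem exists_isotopic_mollify [Finite ι] [CompleteSpace E] {f h : ι → ℝ → E} {K : NNReal}
    (hh : ∀ i, LipschitzWith K (h i))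
    (ht : ∀ s ∈ Icc (0 : ℝ) 1, Tame fun i t => f i t + s • h i t) :
    ∃ ε > 0, ∀ φ : ContDiffBump (0 : ℝ), φ.rOut < ε →
      Isotopic (fun i => mollify φ (f i)) (fun i => mollify φ fun t => f i t + h i t) := by
  obtain ⟨ε, hε, H⟩ := exists_mollify_segment hh ht
  have hf : ∀ i, Continuous (f i) := fun i => by
    simpa using ((ht 0 (by simp)).lipschitz.choose_spec i).continuous
  refine ⟨ε, hε, fun φ hφ => ?_⟩
  have h1 : (fun i => mollify φ fun t => f i t + h i t)
      = fun i t => mollify φ (f i) t + mollify φ (h i) t := by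
    ext i t
    simpa using mollify_add_smul φ (hf i) (hh i).continuous 1 t
  rw [h1]
  refine Isotopic.of_segment (fun i => mollify_contDiff φ (hf i))
    (fun i => mollify_contDiff φ (hh i).continuous) fun s hs => ?_
  refine H φ hφ s hs 1 (by simp) _ ?_ fun i => ?_
  · ext i t
    rw [mollify_add_smul φ (hf i) (hh i).continuous]
    simp
  · exact (mollify_contDiff φ (hf i)).add
      (contDiff_const.smul (mollify_contDiff φ (hh i).continuous))

/-- A smooth tame link is isotopic to its sufficiently fine mollifications. -/
theorem exists_isotopic_mollify_self [Finite ι] [CompleteSpace E] {f : ι → ℝ → E} (ht : Tame f)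
    (hf : ∀ i, ContDiff ℝ ∞ (f i)) :
    ∃ ε > 0, ∀ φ : ContDiffBump (0 : ℝ), φ.rOut < ε → Isotopic f fun i => mollify φ (f i) := by
  obtain ⟨ε, hε, H⟩ := exists_mollify_segment (f := f) (h := fun _ _ => 0) (K := 0)
    (fun i => LipschitzWith.const _) (fun s _ => by simpa using ht)
  simp only [smul_zero, add_zero] at H
  refine ⟨ε, hε, fun φ hφ => ?_⟩
  have hm : ∀ i, ContDiff ℝ ∞ fun t => mollify φ (f i) t - f i t := fun i =>
    (mollify_contDiff φ (hf i).continuous).sub (hf i)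
  have h1 : (fun i => mollify φ (f i)) = fun i t => f i t + (mollify φ (f i) t - f i t) := by
    simp
  rw [h1]
  refine Isotopic.of_segment hf hm fun s hs => ?_
  exact H φ hφ 0 (by simp) s hs _ rfl fun i => (hf i).add (contDiff_const.smul (hm i))

end Links

section PiecewiseLinear

variable {ι E : Type*} [NormedAddCommGroup E] [NormedSpace ℝ E]

theorem lipschitzWith_of_periodic {g : ℝ → E} {K : NNReal} (hg : Function.Periodic g 1)
    (h : LipschitzOnWith K g (Icc (-1) 2)) : LipschitzWith K g := by
  refine LipschitzWith.of_dist_le_mul fun t u => ?_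
  set t' := t - ⌊t⌋ with ht'
  set u' := u - ⌊t⌋ - round (u - t) with hu'
  have h1 : g t' = g t := by
    have := hg.sub_int_mul_eq ⌊t⌋ (x := t)
    rwa [mul_one] at this
  have h2 : g u' = g u := by
    have h1 := hg.sub_int_mul_eq (round (u - t)) (x := u - ⌊t⌋)
    have h2 := hg.sub_int_mul_eq ⌊t⌋ (x := u)
    rw [mul_one] at h1 h2
    rw [hu', h1, h2]
  have h3 : t' ∈ Ico (0 : ℝ) 1 := ⟨Int.fract_nonneg t, Int.fract_lt_one t⟩
  have h4 : u' - t' = u - t - round (u - t) := by rw [hu', ht']; ring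
  have h5 := abs_le.1 (h4 ▸ abs_sub_round (u - t))
  have h6 : |u' - t'| ≤ |u - t| := by
    rw [h4]; simpa using round_le (u - t) 0
  have h7 := h.dist_le_mul t' ⟨by linarith [h3.1], by linarith [h3.2]⟩ u'
    ⟨by linarith [h3.1], by linarith [h3.2]⟩
  rw [← h1, ← h2]
  refine h7.trans (mul_le_mul_of_nonneg_left ?_ K.2)
  rwa [Real.dist_eq, Real.dist_eq, abs_sub_comm, abs_sub_comm t u]

theorem exists_lipschitzWith_of_periodic {g : ℝ → E} (hg : Function.Periodic g 1)
    (h : LocallyLipschitz g) : ∃ K, LipschitzWith K g := by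
  obtain ⟨K, hK⟩ := h.locallyLipschitzOn.exists_lipschitzOnWith_of_compact
    (isCompact_Icc (a := (-1 : ℝ)) (b := 2))
  exact ⟨K, lipschitzWith_of_periodic hg hK⟩

theorem exists_lipschitzWith_forall [Finite ι] {f : ι → ℝ → E}
    (h : ∀ i, ∃ K, LipschitzWith K (f i)) : ∃ K, ∀ i, LipschitzWith K (f i) := by
  have := Fintype.ofFinite ι
  choose K hK using h
  exact ⟨∑ i, K i, fun i => (hK i).weaken (Finset.single_le_sum (fun _ _ => zero_le)
    (Finset.mem_univ i))⟩

theorem IsLoopLink.tame [Finite ι] {f : ι → ℝ → E} (hf : IsLoopLink f) : Tame f := by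
  refine ⟨hf.periodic, exists_lipschitzWith_forall fun i =>
    exists_lipschitzWith_of_periodic (hf.periodic i)
      ((hf.smooth i).of_le (by exact_mod_cast le_top)).locallyLipschitz, hf.inj, fun i x => ?_⟩
  have hpos := norm_pos_iff.2 (hf.deriv_ne i x)
  obtain ⟨ℓ, -, hℓ⟩ := exists_dual_vector'' ℝ (deriv (f i) x)
  have hdiff := (hf.smooth i).differentiable (by simp)
  have hc : Continuous fun t => ℓ (deriv (f i) t) :=
    ℓ.continuous.comp ((hf.smooth i).continuous_deriv (by simp))
  have hev : ∀ᶠ t in 𝓝 x, ‖deriv (f i) x‖ / 2 < ℓ (deriv (f i) t) := by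
    refine hc.continuousAt.eventually (lt_mem_nhds ?_)
    simpa [hℓ] using hpos
  obtain ⟨r, hr, hball⟩ := Metric.nhds_basis_closedBall.eventually_iff.1 hev
  refine ⟨ℓ, ‖deriv (f i) x‖ / 2, r, by positivity, hr, fun t u h1 h2 h3 => ?_⟩
  have hder : ∀ t, HasDerivAt (fun t => ℓ (f i t)) (ℓ (deriv (f i) t)) t := fun t =>
    ℓ.hasFDerivAt.comp_hasDerivAt t (hdiff t).hasDerivAt
  have := (convex_Icc (x - r) (x + r)).mul_sub_le_image_sub_of_le_deriv
    (f := fun t => ℓ (f i t)) (C := ‖deriv (f i) x‖ / 2)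
    (fun t _ => (hder t).continuousAt.continuousWithinAt)
    (fun t _ => (hder t).differentiableAt.differentiableWithinAt) (fun t ht => by
      rw [(hder t).deriv]
      refine (hball ?_).le
      have := interior_subset ht
      rw [Metric.mem_closedBall, Real.dist_eq, abs_le]
      constructor <;> linarith [this.1, this.2]) t ⟨h1, by linarith⟩ u ⟨by linarith, h3⟩ h2
  rw [map_sub]
  exact this

/-- Local affineness on both sides of every point. -/
def IsPL (g : ℝ → E) : Prop :=
  ∀ t₀, ∃ p q : E, (∀ᶠ t in 𝓝[≤] t₀, g t = g t₀ + (t - t₀) • p) ∧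
    ∀ᶠ t in 𝓝[≥] t₀, g t = g t₀ + (t - t₀) • q

theorem IsPL.add {g h : ℝ → E} (hg : IsPL g) (hh : IsPL h) : IsPL fun t => g t + h t := by
  intro t₀
  obtain ⟨p, q, hp, hq⟩ := hg t₀
  obtain ⟨p', q', hp', hq'⟩ := hh t₀
  refine ⟨p + p', q + q', ?_, ?_⟩
  · filter_upwards [hp, hp'] with t h1 h2
    rw [h1, h2, smul_add]; abel
  · filter_upwards [hq, hq'] with t h1 h2
    rw [h1, h2, smul_add]; abel

theorem IsPL.const_smul {g : ℝ → E} (hg : IsPL g) (s : ℝ) : IsPL fun t => s • g t := by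
  intro t₀
  obtain ⟨p, q, hp, hq⟩ := hg t₀
  refine ⟨s • p, s • q, ?_, ?_⟩
  · filter_upwards [hp] with t h1
    rw [h1, smul_add, smul_comm]
  · filter_upwards [hq] with t h1
    rw [h1, smul_add, smul_comm]

theorem IsPL.exists_radius {g : ℝ → E} (hg : IsPL g) (t₀ : ℝ) : ∃ (p q : E) (r : ℝ), 0 < r ∧
    (∀ t ∈ Icc (t₀ - r) t₀, g t = g t₀ + (t - t₀) • p) ∧
    ∀ t ∈ Icc t₀ (t₀ + r), g t = g t₀ + (t - t₀) • q := by
  obtain ⟨p, q, hp, hq⟩ := hg t₀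
  obtain ⟨a, ha, hp⟩ := (mem_nhdsLE_iff_exists_Icc_subset).1 hp
  obtain ⟨b, hb, hq⟩ := (mem_nhdsGE_iff_exists_Icc_subset).1 hq
  have ha : a < t₀ := ha
  have hb : t₀ < b := hb
  have h1 := min_le_left (t₀ - a) (b - t₀)
  have h2 := min_le_right (t₀ - a) (b - t₀)
  exact ⟨p, q, min (t₀ - a) (b - t₀), lt_min (by linarith) (by linarith),
    fun t ht => hp ⟨by linarith [ht.1], ht.2⟩, fun t ht => hq ⟨ht.1, by linarith [ht.2]⟩⟩

theorem IsPL.locallyLipschitz {g : ℝ → E} (hg : IsPL g) : LocallyLipschitz g := by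
  intro x
  obtain ⟨p, q, r, hr, hp, hq⟩ := hg.exists_radius x
  have key : ∀ t ∈ Icc (x - r) (x + r), ∀ u ∈ Icc (x - r) (x + r), t ≤ u →
      dist (g t) (g u) ≤ (‖p‖ + ‖q‖) * (u - t) := by
    intro t ht u hu htu
    have np := norm_nonneg p
    have nq := norm_nonneg q
    rw [dist_comm, dist_eq_norm]
    rcases le_total u x with hux | hux
    · rw [hp t ⟨ht.1, htu.trans hux⟩, hp u ⟨hu.1, hux⟩, add_sub_add_left_eq_sub, ← sub_smul,
        sub_sub_sub_cancel_right, norm_smul, Real.norm_of_nonneg (by linarith)]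
      nlinarith
    rcases le_total t x with htx | htx
    · rw [hp t ⟨ht.1, htx⟩, hq u ⟨hux, hu.2⟩, add_sub_add_left_eq_sub]
      refine (norm_sub_le _ _).trans ?_
      rw [norm_smul, norm_smul, Real.norm_of_nonneg (by linarith : 0 ≤ u - x),
        Real.norm_of_nonpos (by linarith : t - x ≤ 0)]
      nlinarith
    · rw [hq t ⟨htx, ht.2⟩, hq u ⟨hux, hu.2⟩, add_sub_add_left_eq_sub, ← sub_smul,
        sub_sub_sub_cancel_right, norm_smul, Real.norm_of_nonneg (by linarith)]
      nlinarith
  refine ⟨‖p‖₊ + ‖q‖₊, Icc (x - r) (x + r), Icc_mem_nhds (by linarith) (by linarith),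
    LipschitzOnWith.of_dist_le_mul fun t ht u hu => ?_⟩
  rcases le_total t u with h | h
  · refine (key t ht u hu h).trans_eq ?_
    rw [Real.dist_eq, abs_sub_comm, abs_of_nonneg (sub_nonneg.2 h)]
    simp
  · rw [dist_comm]
    refine (key u hu t ht h).trans_eq ?_
    rw [Real.dist_eq, abs_of_nonneg (sub_nonneg.2 h)]
    simp

theorem IsPL.tame [Finite ι] {f : ι → ℝ → E} (hf : ∀ i, IsPL (f i))
    (hper : ∀ i, Function.Periodic (f i) 1) (hinj : InjMod f) : Tame f := by
  refine ⟨hper, exists_lipschitzWith_forall fun i =>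
    exists_lipschitzWith_of_periodic (hper i) (hf i).locallyLipschitz, hinj, fun i x => ?_⟩
  obtain ⟨p, q, r, hr, hp, hq⟩ := (hf i).exists_radius x
  have h0 : (0 : E) ∉ segment ℝ p q := by
    rintro ⟨a, b, ha, hb, hab, h⟩
    set τ := min r (1 / 2) with hτ
    have hτ0 : 0 < τ := lt_min hr (by norm_num)
    have hτr : τ ≤ r := min_le_left _ _
    have hτ1 : τ ≤ 1 / 2 := min_le_right _ _
    have h1 := hp (x - a * τ) ⟨by nlinarith, by nlinarith⟩
    have h2 := hq (x + b * τ) ⟨by nlinarith, by nlinarith⟩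
    have h3 : f i (x + b * τ) = f i (x - a * τ) := by
      have e : (x + b * τ - x) • q - (x - a * τ - x) • p = τ • (a • p + b • q) := by module
      rw [h, smul_zero, sub_eq_zero] at e
      rw [h1, h2, e]
    obtain ⟨-, k, hk⟩ := hinj i i _ _ h3
    have hk' : (k : ℝ) = τ := by
      have : b * τ + a * τ = τ := by rw [← add_mul, add_comm b, hab, one_mul]
      linarith
    have k0 : (0 : ℤ) < k := by
      have : (0 : ℝ) < k := by linarith
      exact_mod_cast this
    have k1 : k < 1 := by
      have : (k : ℝ) < 1 := by linarith
      exact_mod_cast this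
    omega
  have hcl : IsClosed (segment ℝ p q) := by
    rw [segment_eq_image_lineMap]
    exact (isCompact_Icc.image AffineMap.lineMap_continuous).isClosed
  obtain ⟨ℓ, a, ha, hℓ⟩ := geometric_hahn_banach_point_closed (convex_segment p q) hcl h0
  rw [map_zero] at ha
  have hℓp := hℓ p (left_mem_segment ℝ p q)
  have hℓq := hℓ q (right_mem_segment ℝ p q)
  refine ⟨ℓ, a, r, ha, hr, fun t u h1 h2 h3 => ?_⟩
  rw [map_sub]
  rcases le_total u x with hux | hux
  · rw [hp t ⟨h1, h2.trans hux⟩, hp u ⟨h1.trans h2, hux⟩]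
    simp only [map_add, map_smul, smul_eq_mul]
    nlinarith
  rcases le_total t x with htx | htx
  · rw [hp t ⟨h1, htx⟩, hq u ⟨hux, h3⟩]
    simp only [map_add, map_smul, smul_eq_mul]
    nlinarith
  · rw [hq t ⟨htx, h2.trans h3⟩, hq u ⟨hux, h3⟩]
    simp only [map_add, map_smul, smul_eq_mul]
    nlinarith

end PiecewiseLinear

section Polygon

variable {ι E : Type*} [NormedAddCommGroup E] [NormedSpace ℝ E]

/-- The polygon which interpolates `V k` at the points `k / m`. -/
noncomputable def polygon (m : ℕ) (V : ℤ → E) (t : ℝ) : E :=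
  V ⌊m * t⌋ + Int.fract (m * t) • (V (⌊m * t⌋ + 1) - V ⌊m * t⌋)

theorem polygon_eq {m : ℕ} (hm : 0 < m) (V : ℤ → E) (k : ℤ) {t : ℝ}
    (ht : t ∈ Icc (k / m : ℝ) ((k + 1) / m)) :
    polygon m V t = V k + (m * t - k) • (V (k + 1) - V k) := by
  have hm' : (0 : ℝ) < m := by exact_mod_cast hm
  have h1 : (k : ℝ) ≤ m * t := by rw [mul_comm]; exact (div_le_iff₀ hm').1 ht.1
  have h2 : m * t ≤ k + 1 := by rw [mul_comm]; exact (le_div_iff₀ hm').1 ht.2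
  rcases h2.lt_or_eq with h2 | h2
  · have : ⌊m * t⌋ = k := Int.floor_eq_iff.2 ⟨h1, h2⟩
    rw [polygon, Int.fract, this]
  · have : ⌊m * t⌋ = k + 1 := by rw [h2]; exact_mod_cast Int.floor_intCast (R := ℝ) (k + 1)
    rw [polygon, Int.fract, this, h2]
    simp

theorem polygon_periodic {m : ℕ} {V : ℤ → E} (hV : ∀ k, V (k + m) = V k) :
    Function.Periodic (polygon m V) 1 := by
  intro t
  have h1 : (m * (t + 1) : ℝ) = m * t + (m : ℤ) := by push_cast; ring
  have h2 : V (⌊m * t⌋ + m + 1) = V (⌊m * t⌋ + 1) := by rw [← hV (⌊m * t⌋ + 1)]; congr 1; ring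
  simp only [polygon]
  rw [h1, Int.floor_add_intCast, Int.fract_add_intCast, hV, h2]

theorem mem_cell {m : ℕ} (hm : 0 < m) (t : ℝ) :
    t ∈ Ico (⌊m * t⌋ / m : ℝ) ((⌊m * t⌋ + 1) / m) := by
  have hm' : (0 : ℝ) < m := by exact_mod_cast hm
  exact ⟨by rw [div_le_iff₀ hm', mul_comm]; exact Int.floor_le _,
    by rw [lt_div_iff₀ hm', mul_comm]; exact Int.lt_floor_add_one _⟩

theorem polygon_isPL {m : ℕ} (hm : 0 < m) (V : ℤ → E) : IsPL (polygon m V) := by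
  have hm' : (0 : ℝ) < m := by exact_mod_cast hm
  intro t
  have key : ∀ k : ℤ, ∀ t ∈ Icc (k / m : ℝ) ((k + 1) / m), ∀ u ∈ Icc (k / m : ℝ) ((k + 1) / m),
      polygon m V u = polygon m V t + (u - t) • (m : ℝ) • (V (k + 1) - V k) := by
    intro k t ht u hu
    rw [polygon_eq hm V k ht, polygon_eq hm V k hu]
    module
  have hR := mem_cell hm t
  set k := ⌊m * t⌋ with hk
  have hL : ∃ k' : ℤ, t ∈ Ioc (k' / m : ℝ) ((k' + 1) / m) := by
    rcases hR.1.lt_or_eq with h | h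
    · exact ⟨k, h, hR.2.le⟩
    · refine ⟨k - 1, ?_, ?_⟩
      · rw [← h]; push_cast; gcongr; linarith
      · rw [← h]; push_cast; gcongr; linarith
  obtain ⟨k', hk'⟩ := hL
  refine ⟨(m : ℝ) • (V (k' + 1) - V k'), (m : ℝ) • (V (k + 1) - V k), ?_, ?_⟩
  · filter_upwards [Icc_mem_nhdsLE hk'.1] with u hu
    exact key k' t ⟨hk'.1.le, hk'.2⟩ u ⟨hu.1, hu.2.trans hk'.2⟩
  · filter_upwards [Icc_mem_nhdsGE hR.2] with u hu
    exact key k t ⟨hR.1, hR.2.le⟩ u ⟨hR.1.trans hu.1, hu.2⟩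

theorem norm_sub_sub_smul_deriv_le {f : ℝ → E} (hf : Differentiable ℝ f) {K : NNReal}
    (hK : LipschitzWith K (deriv f)) {a b t : ℝ} (hab : a ≤ b) (ht : t ∈ Icc a b) :
    ‖f b - f a - (b - a) • deriv f t‖ ≤ K * (b - a) ^ 2 := by
  have hder : ∀ x, HasDerivAt (fun x => f x - x • deriv f t) (deriv f x - deriv f t) x := by
    intro x
    have := (hf x).hasDerivAt.sub ((hasDerivAt_id x).smul_const (deriv f t))
    rw [one_smul] at this
    exact this
  have := (convex_Icc a b).norm_image_sub_le_of_norm_hasDerivWithin_le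
    (C := K * (b - a)) (fun x _ => (hder x).hasDerivWithinAt) (fun x hx => by
      have h1 := hK.dist_le_mul x t
      rw [dist_eq_norm] at h1
      refine h1.trans (mul_le_mul_of_nonneg_left ?_ K.2)
      rw [Real.dist_eq, abs_le]
      constructor <;> linarith [hx.1, hx.2, ht.1, ht.2])
    (left_mem_Icc.2 hab) (right_mem_Icc.2 hab)
  rw [Real.norm_of_nonneg (sub_nonneg.2 hab)] at this
  convert this using 1
  · congr 1; module
  · ring

theorem lipschitzWith_of_right_deriv {g : ℝ → E} (hg : Continuous g) {K : NNReal}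
    (h : ∀ t, ∃ g', ‖g'‖ ≤ K ∧ HasDerivWithinAt g g' (Ici t) t) : LipschitzWith K g := by
  choose g' hb hd using h
  have key : ∀ t u, t ≤ u → ‖g u - g t‖ ≤ K * (u - t) := fun t u htu =>
    norm_image_sub_le_of_norm_deriv_right_le_segment hg.continuousOn (fun x _ => hd x)
      (fun x _ => hb x) u (right_mem_Icc.2 htu)
  refine LipschitzWith.of_dist_le_mul fun t u => ?_
  rcases le_total t u with h | h
  · rw [dist_comm, dist_eq_norm, dist_comm, Real.dist_eq, abs_of_nonneg (sub_nonneg.2 h)]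
    exact key t u h
  · rw [dist_eq_norm, Real.dist_eq, abs_of_nonneg (sub_nonneg.2 h)]
    exact key u t h

/-- A fine polygon with vertices close to a smooth curve is close to it in the Lipschitz sense. -/
theorem polygon_sub_lipschitz {f : ℝ → E} (hf : Differentiable ℝ f) {K δ : NNReal}
    (hK : LipschitzWith K (deriv f)) {m : ℕ} (hm : 0 < m) {V : ℤ → E} {ε : ℝ}
    (hV : ∀ k : ℤ, ‖V k - f (k / m)‖ ≤ ε) (hδ : K / m + 2 * m * ε ≤ δ) :
    LipschitzWith δ fun t => polygon m V t - f t := by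
  have hm' : (0 : ℝ) < m := by exact_mod_cast hm
  refine lipschitzWith_of_right_deriv ((polygon_isPL hm V).locallyLipschitz.continuous.sub
    hf.continuous) fun t => ?_
  have ht := mem_cell hm t
  set k := ⌊m * t⌋ with hk
  refine ⟨(m : ℝ) • (V (k + 1) - V k) - deriv f t, ?_, ?_⟩
  · have h1 := norm_sub_sub_smul_deriv_le hf hK (a := k / m) (b := (k + 1) / m) (t := t)
      (by gcongr; linarith) ⟨ht.1, ht.2.le⟩
    have h2 : ((k + 1) / m - k / m : ℝ) = 1 / m := by ring
    rw [h2] at h1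
    have e : (m : ℝ) • (V (k + 1) - V k) - deriv f t
        = (m : ℝ) • ((V (k + 1) - f ((k + 1) / m)) - (V k - f (k / m)))
        + (m : ℝ) • (f ((k + 1) / m) - f (k / m) - (1 / m : ℝ) • deriv f t) := by
      rw [smul_sub (m : ℝ) (f ((k + 1) / m) - f (k / m)), smul_smul, mul_one_div_cancel hm'.ne']
      module
    have h3 := hV (k + 1)
    push_cast at h3
    have h4 := norm_sub_le (V (k + 1) - f ((k + 1) / m)) (V k - f (k / m))
    have h5 := hV k
    rw [e]
    refine (norm_add_le _ _).trans (le_trans ?_ hδ)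
    rw [norm_smul, norm_smul, Real.norm_of_nonneg hm'.le, add_comm]
    refine add_le_add ?_ ?_
    · calc (m : ℝ) * _ ≤ m * (K * (1 / m) ^ 2) := mul_le_mul_of_nonneg_left h1 hm'.le
        _ = K / m := by field_simp
    · nlinarith
  · refine HasDerivWithinAt.sub ?_ (hf t).hasDerivAt.hasDerivWithinAt
    have h1 : HasDerivAt (fun u : ℝ => V k + (m * u - k) • (V (k + 1) - V k))
        ((m : ℝ) • (V (k + 1) - V k)) t := by
      have := ((((hasDerivAt_id t).const_mul (m : ℝ)).sub_const (k : ℝ)).smul_const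
        (V (k + 1) - V k)).const_add (V k)
      simpa using this
    refine h1.hasDerivWithinAt.congr_of_eventuallyEq ?_ (polygon_eq hm V k ⟨ht.1, ht.2.le⟩)
    filter_upwards [Icc_mem_nhdsGE ht.2] with u hu
    exact polygon_eq hm V k ⟨ht.1.trans hu.1, hu.2⟩

theorem deriv_periodic {f : ℝ → E} (hf : Function.Periodic f 1) :
    Function.Periodic (deriv f) 1 := by
  intro t
  rw [← deriv_comp_add_const]
  congr 1
  exact funext hf

end Polygon

/-- The planar determinant of two vectors of space. -/
def planarDet (v w : ℝ × ℝ × ℝ) : ℝ := v.1 * w.2.1 - v.2.1 * w.1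

theorem finite_quadratic_zeros (a b : ℝ) {c : ℝ} (hc : c ≠ 0) :
    {x : ℝ | a + b * x + c * x ^ 2 = 0}.Finite := by
  have hp : (Polynomial.C c * Polynomial.X ^ 2 + Polynomial.C b * Polynomial.X
      + Polynomial.C a : Polynomial ℝ) ≠ 0 := fun h => hc (by
    have := Polynomial.leadingCoeff_quadratic (b := b) (c := a) hc
    rw [h] at this
    simpa using this.symm)
  refine (Polynomial.finite_setOfPred_isRoot hp).subset fun x hx => ?_
  simp only [mem_ofPred_eq, Polynomial.IsRoot, Polynomial.eval_add, Polynomial.eval_mul,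
    Polynomial.eval_C, Polynomial.eval_pow, Polynomial.eval_X] at hx ⊢
  linarith

/-- A smooth link is joined by a segment of tame links to a polygonal link none of whose edges
spans a plane through the axis. -/
theorem exists_generic_polygon {ι : Type*} [Finite ι] {f : ι → ℝ → ℝ × ℝ × ℝ}
    (hf : IsLoopLink f) :
    ∃ (m : ℕ) (g : ι → ℝ → ℝ × ℝ × ℝ), 1 < m ∧ (∀ i, Function.Periodic (g i) 1) ∧
      (∀ i, IsPL (g i)) ∧
      (∀ i (k : ℤ), ∃ P D, planarDet P D ≠ 0 ∧
        ∀ t ∈ Icc (k / m : ℝ) ((k + 1) / m), g i t = P + (t - k / m) • D) ∧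
      ∀ s ∈ Icc (0 : ℝ) 1, Tame fun i t => f i t + s • (g i t - f i t) := by
  obtain ⟨δ, hδ, hpert⟩ := hf.tame.exists_perturb
  have hdiff : ∀ i, Differentiable ℝ (f i) := fun i => (hf.smooth i).differentiable (by simp)
  obtain ⟨K, hK⟩ := exists_lipschitzWith_forall fun i =>
    exists_lipschitzWith_of_periodic (deriv_periodic (hf.periodic i))
      (((contDiff_infty_iff_deriv.1 (hf.smooth i)).2.of_le
        (by exact_mod_cast le_top)).locallyLipschitz (𝕂 := ℝ))
  have hδ' : (0 : ℝ) < δ := by exact_mod_cast hδ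
  obtain ⟨m, hm⟩ := exists_nat_ge (max 3 (2 * K / δ : ℝ))
  have hm3 : (3 : ℝ) ≤ m := (le_max_left _ _).trans hm
  have hmK : 2 * K / δ ≤ (m : ℝ) := (le_max_right _ _).trans hm
  have hm' : (0 : ℝ) < m := by linarith
  have hm0 : 0 < m := by exact_mod_cast hm'
  have hm1 : (1 : ℝ) < m := by linarith
  set e : ℤ → ℝ × ℝ × ℝ := fun k => (Real.cos (2 * π * k / m), Real.sin (2 * π * k / m), 0) with he
  have hsin : 0 < Real.sin (2 * π / m) := by
    apply Real.sin_pos_of_pos_of_lt_pi (by positivity)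
    rw [div_lt_iff₀ hm']
    nlinarith [Real.pi_pos]
  have hee : ∀ k, planarDet (e k) (e (k + 1)) = Real.sin (2 * π / m) := by
    intro k
    have : 2 * π / m = 2 * π * ((k + 1 : ℤ) : ℝ) / m - 2 * π * k / m := by push_cast; ring
    rw [this, Real.sin_sub]
    simp only [planarDet, he]
    ring
  have hne : ∀ k, ‖e k‖ ≤ 1 := by
    intro k
    simp only [he, Prod.norm_def, norm_zero, Real.norm_eq_abs]
    exact max_le (Real.abs_cos_le_one _) (max_le (Real.abs_sin_le_one _) zero_le_one)
  have hper_e : ∀ k : ℤ, e (k + m) = e k := by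
    intro k
    have : 2 * π * ((k + m : ℤ) : ℝ) / m = 2 * π * k / m + 2 * π := by
      push_cast; field_simp
    simp only [he, this, Real.cos_add_two_pi, Real.sin_add_two_pi]
  have hbad : (⋃ i, ⋃ k : ℤ, {ε : ℝ | planarDet (f i (k / m)) (f i ((k + 1) / m))
      + (planarDet (f i (k / m)) (e (k + 1)) + planarDet (e k) (f i ((k + 1) / m))) * ε
      + planarDet (e k) (e (k + 1)) * ε ^ 2 = 0}).Countable :=
    countable_iUnion fun i => countable_iUnion fun k =>
      (finite_quadratic_zeros _ _ ((hee k).symm ▸ hsin.ne')).countable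
  have hε0 : 0 < δ / (4 * m : ℝ) := by positivity
  obtain ⟨ε, ⟨hε1, hε2⟩, hε3⟩ : ∃ ε ∈ Ioo 0 (δ / (4 * m : ℝ)), ε ∉ _ :=
    not_subset.1 fun h => not_le.2 hε0 (Cardinal.Real.Ioo_countable_iff.1 (hbad.mono h))
  simp only [mem_iUnion, not_exists] at hε3
  rw [lt_div_iff₀ (by positivity)] at hε2
  set V : ι → ℤ → ℝ × ℝ × ℝ := fun i k => f i (k / m) + ε • e k with hV
  have hVf : ∀ i (k : ℤ), ‖V i k - f i (k / m)‖ ≤ ε := by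
    intro i k
    simp only [hV, add_sub_cancel_left, norm_smul, Real.norm_of_nonneg hε1.le]
    exact mul_le_of_le_one_right hε1.le (hne k)
  have hVper : ∀ i (k : ℤ), V i (k + m) = V i k := by
    intro i k
    have : (((k + m : ℤ) : ℝ) / m) = k / m + 1 := by push_cast; field_simp
    simp only [hV, this, hper_e]
    rw [hf.periodic i]
  have hKm : (K : ℝ) / m ≤ δ / 2 := by
    rw [div_le_iff₀ hδ'] at hmK
    rw [div_le_iff₀ hm']
    linarith
  have hlip : ∀ i, LipschitzWith (δ / 2 + δ / 2) fun t => polygon m (V i) t - f i t := fun i =>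
    polygon_sub_lipschitz (hdiff i) (hK i) hm0 (hVf i) (by push_cast; linarith)
  rw [add_halves] at hlip
  have hper : ∀ i, Function.Periodic (polygon m (V i)) 1 := fun i => polygon_periodic (hVper i)
  have hsup : ∀ i t, ‖polygon m (V i) t - f i t‖ ≤ δ := by
    intro i t
    have ht := mem_cell hm0 t
    set k := ⌊m * t⌋ with hk
    have h1 := (hlip i).dist_le_mul t (k / m)
    have h2 : polygon m (V i) (k / m) = V i k := by
      rw [polygon_eq hm0 (V i) k ⟨le_rfl, by gcongr; linarith⟩, mul_div_cancel₀ _ hm'.ne']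
      simp
    have h3 : t - k / m ≤ 1 / 3 := by
      have : t < k / m + 1 / m := by rw [← add_div]; exact ht.2
      have : 1 / (m : ℝ) ≤ 1 / 3 := by gcongr
      linarith
    rw [h2, dist_eq_norm, Real.dist_eq, abs_of_nonneg (sub_nonneg.2 ht.1)] at h1
    have h4 := norm_le_norm_sub_add (polygon m (V i) t - f i t) (V i k - f i (k / m))
    have h5 := hVf i k
    nlinarith
  refine ⟨m, fun i => polygon m (V i), by exact_mod_cast hm1, hper, fun i => polygon_isPL hm0 _,
    fun i k => ?_,
    fun s hs => ?_⟩
  · refine ⟨V i k, (m : ℝ) • (V i (k + 1) - V i k), ?_, fun t ht => ?_⟩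
    · have h1 := hε3 i k
      have e1 : planarDet (V i k) ((m : ℝ) • (V i (k + 1) - V i k))
          = m * (planarDet (f i (k / m)) (f i ((k + 1) / m))
      + (planarDet (f i (k / m)) (e (k + 1)) + planarDet (e k) (f i ((k + 1) / m))) * ε
      + planarDet (e k) (e (k + 1)) * ε ^ 2) := by
        have e2 : V i (k + 1) = f i ((k + 1) / m) + ε • e (k + 1) := by
          simp only [hV]; push_cast; rfl
        rw [e2]
        simp only [hV, planarDet, Prod.fst_add, Prod.snd_add, Prod.smul_fst, Prod.smul_snd,
          Prod.fst_sub, Prod.snd_sub, smul_eq_mul]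
        ring
      rw [e1]
      exact mul_ne_zero hm'.ne' h1
    · change polygon m (V i) t = _
      rw [polygon_eq hm0 _ k ht, smul_smul, sub_mul, div_mul_cancel₀ _ hm'.ne', mul_comm t]
  · refine hpert _ (fun i t => ?_) (fun i => ?_) fun i t => ?_
    · simp only [(hper i) t, (hf.periodic i) t]
    · refine LipschitzWith.of_dist_le_mul fun t u => ?_
      rw [dist_smul₀, Real.norm_of_nonneg hs.1]
      exact (mul_le_of_le_one_left dist_nonneg hs.2).trans ((hlip i).dist_le_mul t u)
    · rw [norm_smul, Real.norm_of_nonneg hs.1]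
      exact (mul_le_of_le_one_left (norm_nonneg _) hs.2).trans (hsup i t)

section OneSided

variable {E : Type*} [NormedAddCommGroup E] [NormedSpace ℝ E]

/-- `g` is affine with velocity `p` on the left of `t`. -/
def HasLeft (g : ℝ → E) (t : ℝ) (p : E) : Prop := ∀ᶠ u in 𝓝[≤] t, g u = g t + (u - t) • p

/-- `g` is affine with velocity `q` on the right of `t`. -/
def HasRight (g : ℝ → E) (t : ℝ) (q : E) : Prop := ∀ᶠ u in 𝓝[≥] t, g u = g t + (u - t) • q

theorem HasLeft.add {g h : ℝ → E} {t : ℝ} {p p' : E} (hg : HasLeft g t p) (hh : HasLeft h t p') :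
    HasLeft (fun u => g u + h u) t (p + p') := by
  filter_upwards [hg, hh] with t h1 h2
  rw [h1, h2, smul_add]; abel

theorem HasRight.add {g h : ℝ → E} {t : ℝ} {p p' : E} (hg : HasRight g t p)
    (hh : HasRight h t p') : HasRight (fun u => g u + h u) t (p + p') := by
  filter_upwards [hg, hh] with t h1 h2
  rw [h1, h2, smul_add]; abel

theorem HasRight.of_affine {g : ℝ → E} {a b : ℝ} {P D : E}
    (h : ∀ t ∈ Icc a b, g t = P + (t - a) • D) {t : ℝ} (ht : t ∈ Ico a b) : HasRight g t D := by
  filter_upwards [Icc_mem_nhdsGE ht.2] with u h1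
  rw [h u ⟨ht.1.trans h1.1, h1.2⟩, h t ⟨ht.1, ht.2.le⟩]
  module

theorem HasLeft.of_affine {g : ℝ → E} {a b : ℝ} {P D : E}
    (h : ∀ t ∈ Icc a b, g t = P + (t - a) • D) {t : ℝ} (ht : t ∈ Ioc a b) : HasLeft g t D := by
  filter_upwards [Icc_mem_nhdsLE ht.1] with u h1
  rw [h u ⟨h1.1, h1.2.trans ht.2⟩, h t ⟨ht.1.le, ht.2⟩]
  module

end OneSided

theorem planarDet_add_smul (x y z : ℝ × ℝ × ℝ) (c : ℝ) :
    planarDet (x + c • y) z = planarDet x z + c * planarDet y z := by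
  simp only [planarDet, Prod.fst_add, Prod.snd_add, Prod.smul_fst, Prod.smul_snd, smul_eq_mul]
  ring

theorem planarDet_ne_zero {x v q w : ℝ × ℝ × ℝ} (hvq : planarDet v q ≠ 0) (hx : planarDet x w ≠ 0)
    (hvx : planarDet v x = 0) : planarDet q x ≠ 0 := by
  intro h
  have : planarDet v q * planarDet x w
      = planarDet v x * planarDet q w - planarDet q x * planarDet v w := by
    simp only [planarDet]; ring
  rw [hvx, h] at this
  exact mul_ne_zero hvq hx (by simpa using this)

/-- Piecewise linear curves whose one-sided velocities are never coplanar with the axis. -/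
def Generic (g : ℝ → ℝ × ℝ × ℝ) : Prop :=
  ∀ t, ∃ p q, HasLeft g t p ∧ HasRight g t q ∧ planarDet (g t) p ≠ 0 ∧ planarDet (g t) q ≠ 0

theorem Generic.isPL {g : ℝ → ℝ × ℝ × ℝ} (hg : Generic g) : IsPL g := fun t =>
  let ⟨p, q, hp, hq, _⟩ := hg t
  ⟨p, q, hp, hq⟩

theorem Generic.continuous {g : ℝ → ℝ × ℝ × ℝ} (hg : Generic g) : Continuous g :=
  hg.isPL.locallyLipschitz.continuous

theorem Generic.finite_zeros {g : ℝ → ℝ × ℝ × ℝ} (hg : Generic g) {x w : ℝ × ℝ × ℝ}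
    (hx : planarDet x w ≠ 0) {J : Set ℝ} (hJ : IsCompact J) :
    {u ∈ J | planarDet (g u) x = 0}.Finite := by
  suffices {u | u ∈ J ∧ u ∈ {u | planarDet (g u) x = 0}}.Finite from this
  refine hJ.induction_on (p := fun J => {u | u ∈ J ∧ u ∈ {u | planarDet (g u) x = 0}}.Finite)
    (by simp) (fun s t hst ht => ht.subset fun u hu => ⟨hst hu.1, hu.2⟩)
    (fun s t hs ht => (hs.union ht).subset ?_) fun t _ => ?_
  · rintro u ⟨h1 | h1, h2⟩
    exacts [Or.inl ⟨h1, h2⟩, Or.inr ⟨h1, h2⟩]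
  · have key : ∀ᶠ u in 𝓝[≠] t, planarDet (g u) x ≠ 0 := by
      by_cases h0 : planarDet (g t) x = 0
      · obtain ⟨p, q, hp, hq, hp0, hq0⟩ := hg t
        rw [← nhdsLT_sup_nhdsGT, eventually_sup]
        constructor
        · filter_upwards [hp.filter_mono (nhdsWithin_mono _ Iio_subset_Iic_self),
            self_mem_nhdsWithin] with u hu hut
          rw [hu, planarDet_add_smul, h0, zero_add]
          exact mul_ne_zero (sub_ne_zero.2 (ne_of_lt hut)) (planarDet_ne_zero hp0 hx h0)
        · filter_upwards [hq.filter_mono (nhdsWithin_mono _ Ioi_subset_Ici_self),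
            self_mem_nhdsWithin] with u hu hut
          rw [hu, planarDet_add_smul, h0, zero_add]
          exact mul_ne_zero (sub_ne_zero.2 (ne_of_gt hut)) (planarDet_ne_zero hq0 hx h0)
      · have hc : Continuous fun u => planarDet (g u) x := by
          have := hg.continuous
          unfold planarDet
          fun_prop
        exact (hc.continuousAt.eventually_ne h0).filter_mono nhdsWithin_le_nhds
    refine ⟨_, nhdsWithin_le_nhds (eventually_nhdsWithin_iff.1 key),
      (finite_singleton t).subset fun u hu => ?_⟩
    by_contra hut
    exact hu.1 hut hu.2

theorem subsingleton_height {y w : ℝ × ℝ × ℝ} (hy : planarDet y w ≠ 0) (X : ℝ × ℝ × ℝ) :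
    {ζ : ℝ | ∃ τ : ℝ, τ ≠ 0 ∧ y + (2 * τ) • ((0, 0, ζ) - y) = X}.Subsingleton := by
  rintro ζ ⟨τ, hτ, h⟩ ζ' ⟨τ', -, h'⟩
  rw [← h'] at h
  simp only [Prod.ext_iff, Prod.fst_add, Prod.snd_add, Prod.smul_fst, Prod.smul_snd, Prod.fst_sub,
    Prod.snd_sub, smul_eq_mul] at h
  obtain ⟨h1, h2, h3⟩ := h
  have e : τ = τ' := by
    have : 2 * (τ' - τ) * planarDet y w = 0 := by
      unfold planarDet
      linear_combination w.2.1 * h1 - w.1 * h2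
    rcases mul_eq_zero.1 this with h | h
    · linarith
    · exact absurd h hy
  subst e
  have : 2 * τ * (ζ - ζ') = 0 := by linear_combination h3
  rcases mul_eq_zero.1 this with h | h
  · exact absurd h (by simpa using hτ)
  · linarith

theorem subsingleton_slope {P D : ℝ × ℝ × ℝ} (hPD : planarDet P D ≠ 0) (X : ℝ × ℝ × ℝ) :
    {ζ : ℝ | ∃ α β : ℝ, α ≠ 0 ∧ X = α • ((0, 0, ζ) - P) + β • D}.Subsingleton := by
  rintro ζ ⟨α, β, hα, h⟩ ζ' ⟨α', β', -, h'⟩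
  rw [h'] at h
  simp only [Prod.ext_iff, Prod.fst_add, Prod.snd_add, Prod.smul_fst, Prod.smul_snd, Prod.fst_sub,
    Prod.snd_sub, smul_eq_mul] at h
  obtain ⟨h1, h2, h3⟩ := h
  have e : α = α' := by
    have : (α - α') * planarDet P D = 0 := by
      unfold planarDet
      linear_combination D.2.1 * h1 - D.1 * h2
    rcases mul_eq_zero.1 this with h | h
    · linarith
    · exact absurd h hPD
  have e' : β = β' := by
    have : (β' - β) * planarDet P D = 0 := by
      unfold planarDet
      linear_combination P.1 * h2 - P.2.1 * h1
    rcases mul_eq_zero.1 this with h | h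
    · linarith
    · exact absurd h hPD
  subst e e'
  have : α * (ζ - ζ') = 0 := by linear_combination -h3
  rcases mul_eq_zero.1 this with h | h
  · exact absurd h hα
  · linarith

/-- Fingers erected at `t` towards the axis avoid the far part of the link, except for finitely
many heights. -/
theorem finite_bad_heights {ι : Type*} [Finite ι] {g : ι → ℝ → ℝ × ℝ × ℝ}
    (hg : ∀ i, Generic (g i)) {J : ι → Set ℝ} (hJ : ∀ i, IsCompact (J i)) {y w : ℝ × ℝ × ℝ}
    (hy : planarDet y w ≠ 0) (hdisj : ∀ i, ∀ u ∈ J i, y ≠ g i u) :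
    {ζ : ℝ | ∃ τ : ℝ, ∃ i, ∃ u ∈ J i, y + (2 * τ) • ((0, 0, ζ) - y) = g i u}.Finite := by
  refine (finite_iUnion fun i => ((hg i).finite_zeros hy (hJ i)).biUnion fun u _ =>
    (subsingleton_height hy (g i u)).finite).subset ?_
  rintro ζ ⟨τ, i, u, hu, h⟩
  refine mem_iUnion.2 ⟨i, mem_iUnion₂.2 ⟨u, ⟨hu, ?_⟩, τ, ?_, h⟩⟩
  · rw [← h]
    simp only [planarDet, Prod.fst_add, Prod.snd_add, Prod.smul_fst, Prod.smul_snd, Prod.fst_sub,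
      Prod.snd_sub, smul_eq_mul]
    ring
  · rintro rfl
    exact hdisj i u hu (by simpa using h)

theorem exists_good_heights {ι : Type*} [Finite ι] {g : ι → ℝ → ℝ × ℝ × ℝ}
    (hg : ∀ i, Generic (g i)) {J : ι → Set ℝ} (hJ : ∀ i, IsCompact (J i)) {a b : ℝ}
    {γ : ℝ → ℝ × ℝ × ℝ} (hγ : Continuous γ) {w : ℝ × ℝ × ℝ}
    (hw : ∀ t ∈ Icc a b, planarDet (γ t) w ≠ 0)
    (hdisj : ∀ t ∈ Icc a b, ∀ i, ∀ u ∈ J i, γ t ≠ g i u) :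
    ∃ δ > 0, ∀ c ∈ Icc a b, ∃ G : Set ℝ, G.Infinite ∧ ∀ ζ ∈ G, ∀ t, |t - c| < δ →
      ∀ τ ∈ Icc (0 : ℝ) 1, ∀ i, ∀ u ∈ J i, γ t + (2 * τ) • ((0, 0, ζ) - γ c) ≠ g i u := by
  have loc : ∀ t₀ : Icc a b, ∃ r : ℝ, 0 < r ∧ ∃ G : Set ℝ, G.Infinite ∧ ∀ ζ ∈ G, ∀ t c : ℝ,
      |t - t₀| < r → |c - t₀| < r → ∀ τ ∈ Icc (0 : ℝ) 1, ∀ i, ∀ u ∈ J i,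
        γ t + (2 * τ) • ((0, 0, ζ) - γ c) ≠ g i u := by
    rintro ⟨t₀, ht₀⟩
    obtain ⟨ζ₀, hζ₀⟩ := (finite_bad_heights hg hJ (hw t₀ ht₀) (hdisj t₀ ht₀)).exists_notMem
    have ev : ∀ i, ∀ᶠ z : ℝ × ℝ × ℝ in 𝓝 (t₀, t₀, ζ₀), ∀ p ∈ Icc (0 : ℝ) 1 ×ˢ J i,
        γ z.1 + (2 * p.1) • ((0, 0, z.2.2) - γ z.2.1) ≠ g i p.2 := by
      intro i
      refine (isCompact_Icc.prod (hJ i)).eventually_forall_of_forall_eventually ?_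
      rintro ⟨τ, u⟩ ⟨-, hu⟩
      have := (hg i).continuous
      refine ContinuousAt.eventually_ne (g := fun q : (ℝ × ℝ × ℝ) × ℝ × ℝ =>
        γ q.1.1 + (2 * q.2.1) • ((0, 0, q.1.2.2) - γ q.1.2.1) - g i q.2.2) (y := 0) ?_ ?_ |>.mono ?_
      · fun_prop
      · rw [sub_ne_zero]
        intro h
        exact hζ₀ ⟨τ, i, u, hu, h⟩
      · intro q hq
        exact sub_ne_zero.1 hq
    obtain ⟨r, hr, hball⟩ := Metric.eventually_nhds_iff.1 (eventually_all.2 ev)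
    refine ⟨r, hr, Metric.ball ζ₀ r, ?_, fun ζ hζ t c ht hc τ hτ i u hu =>
      hball (y := (t, c, ζ)) ?_ i (τ, u) ⟨hτ, hu⟩⟩
    · rw [Real.ball_eq_Ioo]
      exact Ioo_infinite (by linarith)
    · exact max_lt ht (max_lt hc hζ)
  choose r hr G hG hgood using loc
  obtain ⟨δ, hδ, hcover⟩ := lebesgue_number_lemma_of_metric (isCompact_Icc (a := a) (b := b))
    (c := fun t₀ : Icc a b => Metric.ball (t₀ : ℝ) (r t₀)) (fun _ => Metric.isOpen_ball)
    (fun t ht => mem_iUnion.2 ⟨⟨t, ht⟩, Metric.mem_ball_self (hr _)⟩)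
  refine ⟨δ, hδ, fun c hc => ?_⟩
  obtain ⟨t₀, ht₀⟩ := hcover c hc
  exact ⟨G t₀, hG t₀, fun ζ hζ t ht => hgood t₀ ζ hζ t c (ht₀ ht) (ht₀ (Metric.mem_ball_self hδ))⟩

theorem exists_injOn_choice {G : ℕ → Set ℝ} (N : ℕ) (hG : ∀ j < N, (G j).Infinite) :
    ∃ ζ : ℕ → ℝ, (∀ j < N, ζ j ∈ G j) ∧ ∀ i < N, ∀ j < N, ζ i = ζ j → i = j := by
  induction N with
  | zero => exact ⟨0, by simp⟩
  | succ N ih =>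
    obtain ⟨ζ, h1, h2⟩ := ih fun j hj => hG j (by omega)
    obtain ⟨x, hx, hx'⟩ := ((hG N (by omega)).sdiff
      ((Finset.range N).image ζ).finite_toSet).nonempty
    have hx' : ∀ j < N, ζ j ≠ x := by simpa using hx'
    refine ⟨fun j => if j < N then ζ j else x, fun j hj => ?_, fun i hi j hj h => ?_⟩
    · by_cases h : j < N
      · simpa [h] using h1 j h
      · have : j = N := by omega
        simpa [h, this] using hx
    · by_cases h3 : i < N <;> by_cases h4 : j < N <;> simp only [h3, h4, if_true, if_false] at h
      · exact h2 i h3 j h4 h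
      · exact absurd h (hx' i h3)
      · exact absurd h.symm (hx' j h4)
      · omega

section Finger

variable {E : Type*} [NormedAddCommGroup E] [NormedSpace ℝ E]

theorem polygon_hasRight {m : ℕ} (hm : 0 < m) (V : ℤ → E) (l : ℤ) {t : ℝ}
    (ht : t ∈ Ico (l / m : ℝ) ((l + 1) / m)) :
    HasRight (polygon m V) t ((m : ℝ) • (V (l + 1) - V l)) := by
  have hm' : (m : ℝ) ≠ 0 := by exact_mod_cast hm.ne'
  refine HasRight.of_affine (P := V l) (fun u hu => ?_) ht
  rw [polygon_eq hm V l hu, smul_smul, sub_mul, div_mul_cancel₀ _ hm', mul_comm u]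

theorem polygon_hasLeft {m : ℕ} (hm : 0 < m) (V : ℤ → E) (l : ℤ) {t : ℝ}
    (ht : t ∈ Ioc (l / m : ℝ) ((l + 1) / m)) :
    HasLeft (polygon m V) t ((m : ℝ) • (V (l + 1) - V l)) := by
  have hm' : (m : ℝ) ≠ 0 := by exact_mod_cast hm.ne'
  refine HasLeft.of_affine (P := V l) (fun u hu => ?_) ht
  rw [polygon_eq hm V l hu, smul_smul, sub_mul, div_mul_cancel₀ _ hm', mul_comm u]

/-- Vertices of a polygon on the grid of mesh `1 / (2 * N * m)` which has `N` consecutive spikes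
`w 0, …, w (N - 1)` on the cell `[k / m, (k + 1) / m]` and vanishes on the other cells. -/
noncomputable def spikes (N m : ℕ) (k : ℤ) (w : ℕ → E) (l : ℤ) : E :=
  if (l - 2 * N * k) % (2 * N * m) < 2 * N ∧ (l - 2 * N * k) % (2 * N * m) % 2 = 1 then
    w ((l - 2 * N * k) % (2 * N * m) / 2).toNat else 0

variable {N m : ℕ} {k : ℤ} {w : ℕ → E}

theorem spikes_periodic (l : ℤ) : spikes N m k w (l + (2 * N * m : ℕ)) = spikes N m k w l := by
  have : (l + (2 * N * m : ℕ) - 2 * N * k) % (2 * N * m : ℤ) = (l - 2 * N * k) % (2 * N * m) := by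
    push_cast
    rw [add_sub_right_comm, Int.add_emod_right]
  rw [spikes, this, spikes]

theorem spikes_add (hm : 0 < m) {n : ℤ} (h0 : 0 ≤ n) (h1 : n ≤ 2 * N * m) :
    spikes N m k w (2 * N * k + n) = if n < 2 * N ∧ n % 2 = 1 then w (n / 2).toNat else 0 := by
  rcases h1.lt_or_eq with h1 | h1
  · rw [spikes, add_sub_cancel_left, Int.emod_eq_of_lt h0 h1]
  · have h2 : ¬ n < 2 * N := by
      have : (1 : ℤ) ≤ m := by exact_mod_cast hm
      have : (0 : ℤ) ≤ N := by positivity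
      rw [h1, not_lt]
      nlinarith
    rw [spikes, add_sub_cancel_left, h1, Int.emod_self]
    rw [← h1]
    simp [h2]

theorem spikes_eq_zero (hm : 0 < m) {l : ℤ} (h0 : 2 * N * k + 2 * N ≤ l)
    (h1 : l ≤ 2 * N * k + 2 * N * m) : spikes N m k w l = 0 := by
  have h2 := spikes_add (k := k) (w := w) hm (n := l - 2 * N * k) (by omega) (by linarith)
  rw [add_sub_cancel] at h2
  rw [h2, if_neg]
  omega

theorem polygon_spikes_eq_zero (hN : 0 < N) (hm : 0 < m) {t : ℝ}
    (ht : t ∈ Icc ((k + 1) / m : ℝ) (k / m + 1)) :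
    polygon (2 * N * m) (spikes N m k w) t = 0 := by
  have hL : 0 < 2 * N * m := by positivity
  have hm' : (0 : ℝ) < m := by exact_mod_cast hm
  have hN' : (0 : ℝ) < N := by exact_mod_cast hN
  have h1 : (2 * N * k + 2 * N : ℝ) ≤ (2 * N * m : ℕ) * t := by
    have := (div_le_iff₀ hm').1 ht.1
    push_cast
    nlinarith
  have h2 : (2 * N * m : ℕ) * t ≤ (2 * N * k + 2 * N * m : ℝ) := by
    have h3 := ht.2
    rw [← sub_le_iff_le_add, le_div_iff₀ hm'] at h3
    push_cast
    nlinarith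
  have h3 : 2 * N * k + 2 * N ≤ ⌊(2 * N * m : ℕ) * t⌋ := Int.le_floor.2 (by exact_mod_cast h1)
  rcases h2.lt_or_eq with h2 | h2
  · have h4 : ⌊(2 * N * m : ℕ) * t⌋ < 2 * N * k + 2 * N * m :=
      Int.floor_lt.2 (by exact_mod_cast h2)
    rw [polygon, spikes_eq_zero hm h3 h4.le, spikes_eq_zero hm (by omega) (by omega)]
    simp
  · have h4 : (2 * N * m : ℕ) * t = (2 * N * k + 2 * N * m : ℤ) := by rw [h2]; push_cast; rfl
    rw [h4, Int.floor_intCast] at h3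
    rw [polygon, h4, Int.floor_intCast, Int.fract_intCast, spikes_eq_zero hm h3 le_rfl]
    simp

/-- Description of the spikes on one cell of the grid. -/
theorem polygon_spikes_cell (hm : 0 < m) {l : ℤ} (hl : 2 * N * k ≤ l)
    (hl' : l < 2 * N * k + 2 * N) :
    ∃ j < N, ∃ e : ℝ, (e = 1 ∨ e = -1) ∧
      ((2 * N * m : ℕ) : ℝ) • (spikes N m k w (l + 1) - spikes N m k w l)
        = (e * (2 * N * m : ℕ)) • w j ∧
      ∀ t ∈ Icc (l / (2 * N * m : ℕ) : ℝ) ((l + 1) / (2 * N * m : ℕ)), ∃ σ ∈ Icc (0 : ℝ) 1,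
        (2 * N * m : ℕ) * (t - (2 * N * k + 2 * j + 1) / (2 * N * m : ℕ)) = -e * (1 - σ) ∧
          polygon (2 * N * m) (spikes N m k w) t = σ • w j := by
  have hN : 0 < N := by omega
  have hL : 0 < 2 * N * m := by positivity
  have hm1 : (1 : ℤ) ≤ m := by exact_mod_cast hm
  have hNm : (2 * N : ℤ) ≤ 2 * N * m := le_mul_of_one_le_right (by positivity) hm1
  set L : ℕ := 2 * N * m with hLdef
  have hL' : (0 : ℝ) < L := by exact_mod_cast hL
  have e0 := spikes_add (k := k) (w := w) (N := N) hm (n := l - 2 * N * k) (by omega) (by omega)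
  have e1 := spikes_add (k := k) (w := w) (N := N) hm (n := l + 1 - 2 * N * k) (by omega) (by omega)
  rw [add_sub_cancel] at e0 e1
  have bd : ∀ t ∈ Icc (l / L : ℝ) ((l + 1) / L), 0 ≤ L * t - l ∧ L * t - l ≤ 1 := by
    intro t ht
    have h1 := (div_le_iff₀ hL').1 ht.1
    have h2 := (le_div_iff₀ hL').1 ht.2
    constructor <;> linarith
  obtain ⟨j, hj | hj⟩ : ∃ j : ℕ, l - 2 * N * k = 2 * j ∨ l - 2 * N * k = 2 * j + 1 :=
    ⟨((l - 2 * N * k) / 2).toNat, by omega⟩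
  · have hjN : j < N := by omega
    have hlr : (l : ℝ) = 2 * N * k + 2 * j := by
      have : l = 2 * N * k + 2 * j := by omega
      exact_mod_cast this
    rw [if_neg (by omega)] at e0
    rw [if_pos (by omega), show ((l + 1 - 2 * N * k) / 2).toNat = j by omega] at e1
    refine ⟨j, hjN, 1, Or.inl rfl, by rw [e0, e1, sub_zero, one_mul], fun t ht => ?_⟩
    refine ⟨L * t - l, bd t ht, ?_, ?_⟩
    · rw [mul_sub, mul_div_cancel₀ _ hL'.ne', hlr]; ring
    · rw [polygon_eq hL _ l ht, e0, e1, sub_zero, zero_add]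
  · have hjN : j < N := by omega
    have hlr : (l : ℝ) = 2 * N * k + 2 * j + 1 := by
      have : l = 2 * N * k + 2 * j + 1 := by omega
      exact_mod_cast this
    rw [if_pos (by omega), show ((l - 2 * N * k) / 2).toNat = j by omega] at e0
    rw [if_neg (by omega)] at e1
    refine ⟨j, hjN, -1, Or.inr rfl, by rw [e0, e1]; module, fun t ht => ?_⟩
    refine ⟨1 - (L * t - l), ⟨by linarith [(bd t ht).2], by linarith [(bd t ht).1]⟩, ?_, ?_⟩
    · rw [mul_sub, mul_div_cancel₀ _ hL'.ne', hlr]; ring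
    · rw [polygon_eq hL _ l ht, e0, e1]; module

theorem mem_grid_cell {L : ℕ} (hL : 0 < L) {p q : ℤ} {t : ℝ} (ht : t ∈ Ico (p / L : ℝ) (q / L)) :
    ∃ l : ℤ, p ≤ l ∧ l < q ∧ t ∈ Ico (l / L : ℝ) ((l + 1) / L) := by
  have hL' : (0 : ℝ) < L := by exact_mod_cast hL
  refine ⟨⌊L * t⌋, Int.le_floor.2 ?_, Int.floor_lt.2 ?_, mem_cell hL t⟩
  · rw [mul_comm]; exact (div_le_iff₀ hL').1 ht.1
  · rw [mul_comm]; exact (lt_div_iff₀ hL').1 ht.2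

theorem mem_grid_cell' {L : ℕ} (hL : 0 < L) {p q : ℤ} {t : ℝ} (ht : t ∈ Ioc (p / L : ℝ) (q / L)) :
    ∃ l : ℤ, p ≤ l ∧ l < q ∧ t ∈ Ioc (l / L : ℝ) ((l + 1) / L) := by
  have hL' : (0 : ℝ) < L := by exact_mod_cast hL
  have h1 : p < ⌈L * t⌉ := Int.lt_ceil.2 (by rw [mul_comm]; exact (div_lt_iff₀ hL').1 ht.1)
  have h2 : ⌈L * t⌉ ≤ q := Int.ceil_le.2 (by rw [mul_comm]; exact (le_div_iff₀ hL').1 ht.2)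
  refine ⟨⌈L * t⌉ - 1, by omega, by omega, ?_, ?_⟩
  · rw [div_lt_iff₀ hL']
    have := Int.ceil_lt_add_one (L * t)
    push_cast
    linarith
  · rw [le_div_iff₀ hL']
    have := Int.le_ceil (L * t)
    push_cast
    linarith

end Finger

theorem InjMod.of_Ico {ι E : Type*} {f : ι → ℝ → E} (per : ∀ i, Function.Periodic (f i) 1) (a : ℝ)
    (h : ∀ i j, ∀ t ∈ Ico a (a + 1), ∀ u ∈ Ico a (a + 1), f i t = f j u → i = j ∧ t = u) :
    ∀ i j t u, f i t = f j u → i = j ∧ ∃ k : ℤ, t = u + k := by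
  intro i j t u heq
  have e : ∀ i t, f i (t - ⌊t - a⌋) = f i t := fun i t => by
    have := (per i).sub_int_mul_eq ⌊t - a⌋ (x := t)
    rwa [mul_one] at this
  have hm : ∀ t : ℝ, t - ⌊t - a⌋ ∈ Ico a (a + 1) := fun t =>
    ⟨by linarith [Int.floor_le (t - a)], by linarith [Int.lt_floor_add_one (t - a)]⟩
  obtain ⟨rfl, h2⟩ := h i j _ (hm t) _ (hm u) (by rw [e, e, heq])
  exact ⟨rfl, ⌊t - a⌋ - ⌊u - a⌋, by push_cast; linarith⟩

theorem segment_slope {P D X : ℝ × ℝ × ℝ} {a t c x v τ ζ : ℝ} (hv : v ≠ 0) (hτ : τ ≠ 0)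
    (h : P + (t - a) • D + (2 * τ) • ((0, 0, ζ) - (P + (c - a) • D)) = P + (x - a) • D + v • X) :
    ∃ α β : ℝ, α ≠ 0 ∧ X = α • ((0, 0, ζ) - P) + β • D := by
  refine ⟨v⁻¹ * (2 * τ), v⁻¹ * (t - x - 2 * τ * (c - a)),
    mul_ne_zero (inv_ne_zero hv) (by simpa using hτ), ?_⟩
  have h1 : v • X = (2 * τ) • ((0, 0, ζ) - P) + (t - x - 2 * τ * (c - a)) • D := by
    rw [← sub_eq_iff_eq_add'] at h
    rw [← h]
    module
  rw [mul_smul v⁻¹, mul_smul v⁻¹, ← smul_add, ← h1, inv_smul_smul₀ hv]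

theorem segment_fingers {P D : ℝ × ℝ × ℝ} (hPD : planarDet P D ≠ 0) {a t t' c c' τ τ' ζ ζ' : ℝ}
    (h : P + (t - a) • D + (2 * τ) • ((0, 0, ζ) - (P + (c - a) • D))
      = P + (t' - a) • D + (2 * τ') • ((0, 0, ζ') - (P + (c' - a) • D))) :
    t - t' = 2 * τ * (c - c') ∧ τ * (ζ - ζ') = 0 := by
  simp only [Prod.ext_iff, Prod.fst_add, Prod.snd_add, Prod.smul_fst, Prod.smul_snd, Prod.fst_sub,
    Prod.snd_sub, smul_eq_mul] at h
  obtain ⟨h1, h2, h3⟩ := h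
  have e : τ = τ' := by
    have : 2 * (τ' - τ) * planarDet P D = 0 := by
      unfold planarDet
      linear_combination D.2.1 * h1 - D.1 * h2
    rcases mul_eq_zero.1 this with h | h
    · linarith
    · exact absurd h hPD
  subst e
  have e' : t - t' = 2 * τ * (c - c') := by
    have : (t - t' - 2 * τ * (c - c')) * planarDet P D = 0 := by
      unfold planarDet
      linear_combination P.1 * h2 - P.2.1 * h1
    rcases mul_eq_zero.1 this with h | h
    · linarith
    · exact absurd h hPD
  exact ⟨e', by linear_combination h3 / 2 - e' * D.2.2 / 2⟩

theorem planarDet_finger {P D : ℝ × ℝ × ℝ} {a t c ζ σ e L : ℝ} (he : e = 1 ∨ e = -1)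
    (h : L * (t - c) = -e * (1 - σ)) :
    planarDet (P + (t - a) • D + σ • (2 : ℝ) • ((0, 0, ζ) - (P + (c - a) • D)))
      (D + (e * L) • (2 : ℝ) • ((0, 0, ζ) - (P + (c - a) • D))) = -planarDet P D := by
  have he2 : e * e = 1 := by rcases he with rfl | rfl <;> norm_num
  simp only [planarDet, Prod.fst_add, Prod.snd_add, Prod.smul_fst, Prod.smul_snd, Prod.fst_sub,
    Prod.snd_sub, smul_eq_mul]
  linear_combination (2 * e * (P.1 * D.2.1 - P.2.1 * D.1)) * h
    - 2 * (1 - σ) * (P.1 * D.2.1 - P.2.1 * D.1) * he2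

theorem eq_of_mem_Ico {a t u : ℝ} (ht : t ∈ Ico a (a + 1)) (hu : u ∈ Ico a (a + 1)) {k : ℤ}
    (h : t = u + k) : t = u := by
  have h1 : (-1 : ℝ) < k := by linarith [ht.1, hu.2]
  have h2 : (k : ℝ) < 1 := by linarith [ht.2, hu.1]
  have h3 : k = 0 := by
    have h1 : (-1 : ℤ) < k := by exact_mod_cast h1
    have h2 : k < (1 : ℤ) := by exact_mod_cast h2
    omega
  rw [h, h3, Int.cast_zero, add_zero]

/-- Heights of fingers on the edge `[a, b]` of `g i₀` which avoid the rest of the link. -/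
theorem exists_finger_heights {ι : Type*} [Finite ι] {g : ι → ℝ → ℝ × ℝ × ℝ}
    (hper : ∀ i, Function.Periodic (g i) 1) (hinj : InjMod g) (hgen : ∀ i, Generic (g i)) (i₀ : ι)
    {a b : ℝ} (hab : a < b) (hb1 : b < a + 1) {P D : ℝ × ℝ × ℝ} (hPD : planarDet P D ≠ 0)
    (haff : ∀ t ∈ Icc a b, g i₀ t = P + (t - a) • D) :
    ∃ δ > 0, ∀ c ∈ Icc a b, ∃ G : Set ℝ, G.Infinite ∧ ∀ ζ ∈ G, ∀ t ∈ Icc a b, |t - c| < δ →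
      ∀ τ ∈ Icc (0 : ℝ) 1, ∀ i, ∀ u ∈ Ico a (a + 1), ¬ (i = i₀ ∧ u ≤ b) →
        P + (t - a) • D + (2 * τ) • ((0, 0, ζ) - (P + (c - a) • D)) ≠ g i u := by
  classical
  have hself : ∀ t ∈ Icc a b, ∀ i, ∀ u ∈ Ico a (a + 1), ¬ (i = i₀ ∧ u ≤ b) →
      P + (t - a) • D ≠ g i u := by
    intro t ht i u hu hne h
    rw [← haff t ht] at h
    obtain ⟨rfl, k, hk⟩ := hinj _ _ _ _ h
    have := eq_of_mem_Ico ⟨ht.1, ht.2.trans_lt hb1⟩ hu hk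
    exact hne ⟨rfl, this ▸ ht.2⟩
  obtain ⟨p₁, q, r₁, hr₁, -, hq⟩ := (hgen i₀).isPL.exists_radius b
  obtain ⟨p, q₂, r₂, hr₂, hp, -⟩ := (hgen i₀).isPL.exists_radius (a + 1)
  set J : ι → Set ℝ := fun i => if i = i₀ then Icc (b + r₁) (a + 1 - r₂) else Icc a (a + 1) with hJ
  have hJc : ∀ i, IsCompact (J i) := fun i => by
    simp only [hJ]
    split_ifs <;> exact isCompact_Icc
  obtain ⟨δ, hδ, hgood⟩ := exists_good_heights hgen hJc (a := a) (b := b)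
    (γ := fun t => P + (t - a) • D) (by fun_prop) (w := D) (fun t _ => by
      rw [planarDet_add_smul]
      have : planarDet D D = 0 := by simp only [planarDet]; ring
      rwa [this, mul_zero, add_zero]) (fun t ht i u hu => by
      simp only [hJ] at hu
      split_ifs at hu with h
      · exact hself t ht i u ⟨by linarith [hu.1], by linarith [hu.2]⟩ fun h => by
          linarith [hu.1, h.2]
      · rcases hu.2.lt_or_eq with h1 | h1
        · exact hself t ht i u ⟨hu.1, h1⟩ fun h' => h h'.1
        · rw [h1, hper i]
          exact hself t ht i a ⟨le_rfl, by linarith⟩ fun h' => h h'.1)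
  refine ⟨δ, hδ, fun c hc => ?_⟩
  obtain ⟨G, hG, hgood⟩ := hgood c hc
  refine ⟨G \ ({ζ : ℝ | ∃ α β : ℝ, α ≠ 0 ∧ q = α • ((0, 0, ζ) - P) + β • D} ∪
    {ζ : ℝ | ∃ α β : ℝ, α ≠ 0 ∧ p = α • ((0, 0, ζ) - P) + β • D}),
    hG.sdiff ((subsingleton_slope hPD q).finite.union (subsingleton_slope hPD p).finite), ?_⟩
  rintro ζ ⟨hζ, hζ'⟩ t ht htc τ hτ i u hu hne h
  rw [mem_union, not_or] at hζ'
  rcases eq_or_ne τ 0 with rfl | hτ0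
  · rw [mul_zero, zero_smul, add_zero] at h
    exact hself t ht i u hu hne h
  by_cases huJ : u ∈ J i
  · exact hgood ζ hζ t htc τ hτ i u huJ h
  have hi : i = i₀ := by
    by_contra hi
    simp only [hJ, if_neg hi] at huJ
    exact huJ ⟨hu.1, hu.2.le⟩
  subst hi
  simp only [hJ, if_true, mem_Icc, not_and_or, not_le] at huJ
  have hub : b < u := by
    by_contra h'
    exact hne ⟨rfl, not_lt.1 h'⟩
  rcases huJ with h1 | h1
  · rw [hq u ⟨hub.le, h1.le⟩, haff b ⟨hab.le, le_rfl⟩] at h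
    exact hζ'.1 (segment_slope (sub_ne_zero.2 hub.ne') hτ0 h)
  · rw [hp u ⟨h1.le, hu.2.le⟩, hper, haff a ⟨le_rfl, hab.le⟩] at h
    exact hζ'.2 (segment_slope (sub_ne_zero.2 hu.2.ne) hτ0 h)

/-- Pushing an edge across the axis along many thin fingers makes it positive. -/
theorem exists_finger {ι : Type*} [Finite ι] [DecidableEq ι] {g : ι → ℝ → ℝ × ℝ × ℝ}
    (hper : ∀ i, Function.Periodic (g i) 1) (hinj : InjMod g) (hgen : ∀ i, Generic (g i)) (i₀ : ι)
    {m : ℕ} (hm : 1 < m) (k : ℤ) {P D : ℝ × ℝ × ℝ} (hPD : planarDet P D < 0)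
    (haff : ∀ t ∈ Icc (k / m : ℝ) ((k + 1) / m), g i₀ t = P + (t - k / m) • D) :
    ∃ Ψ : ℝ → ℝ × ℝ × ℝ, Function.Periodic Ψ 1 ∧ IsPL Ψ ∧
      (∀ t ∈ Icc ((k + 1) / m : ℝ) (k / m + 1), Ψ t = 0) ∧
      (∀ s ∈ Icc (0 : ℝ) 1, InjMod fun i t => g i t + s • (if i = i₀ then Ψ t else 0)) ∧
      (∀ t ∈ Ico (k / m : ℝ) ((k + 1) / m), ∃ q,
        HasRight (fun u => g i₀ u + Ψ u) t q ∧ 0 < planarDet (g i₀ t + Ψ t) q) ∧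
      ∀ t ∈ Ioc (k / m : ℝ) ((k + 1) / m), ∃ q,
        HasLeft (fun u => g i₀ u + Ψ u) t q ∧ 0 < planarDet (g i₀ t + Ψ t) q := by
  have hm0 : 0 < m := by omega
  have hm' : (0 : ℝ) < m := by exact_mod_cast hm0
  have hm1 : (1 : ℝ) < m := by exact_mod_cast hm
  set a : ℝ := k / m with ha
  set b : ℝ := (k + 1) / m with hb
  have hab' : b = a + 1 / m := by rw [ha, hb, add_div]
  have h1m : 1 / (m : ℝ) < 1 := by rw [div_lt_one hm']; exact hm1
  have h0m : 0 < 1 / (m : ℝ) := by positivity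
  have hab : a < b := by linarith
  have hb1 : b < a + 1 := by linarith
  obtain ⟨δ, hδ, hG⟩ := exists_finger_heights hper hinj hgen i₀ hab hb1 hPD.ne haff
  obtain ⟨n, hn⟩ := exists_nat_one_div_lt hδ
  set N : ℕ := n + 1 with hN
  have hN0 : 0 < N := by omega
  have hN' : (0 : ℝ) < N := by exact_mod_cast hN0
  have hNδ : 1 / (N : ℝ) < δ := by rw [hN]; exact_mod_cast hn
  have hL0 : 0 < 2 * N * m := by positivity
  have hL : ((2 * N * m : ℕ) : ℝ) = 2 * N * m := by push_cast; rfl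
  have hL' : (0 : ℝ) < (2 * N * m : ℕ) := by exact_mod_cast hL0
  have hLN : 1 / ((2 * N * m : ℕ) : ℝ) < δ := by
    refine lt_of_le_of_lt ?_ hNδ
    gcongr
    nlinarith
  set c : ℕ → ℝ := fun j => (2 * N * k + 2 * j + 1) / (2 * N * m : ℕ) with hc
  have haL : a = ((2 * N * k : ℤ) : ℝ) / (2 * N * m : ℕ) := by
    rw [ha, hL]; push_cast; field_simp
  have hbL : b = ((2 * N * k + 2 * N : ℤ) : ℝ) / (2 * N * m : ℕ) := by
    rw [hb, hL]; push_cast; field_simp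
  have hcab : ∀ j < N, c j ∈ Icc a b := by
    intro j hj
    have hj' : (j : ℝ) + 1 ≤ N := by exact_mod_cast hj
    have hj0 : (0 : ℝ) ≤ j := by positivity
    rw [haL, hbL]
    simp only [hc]
    constructor
    · gcongr; push_cast; linarith
    · gcongr; push_cast; linarith
  have hG' : ∀ j, ∃ G : Set ℝ, j < N → G.Infinite ∧ ∀ ζ ∈ G, ∀ t ∈ Icc a b, |t - c j| < δ →
      ∀ τ ∈ Icc (0 : ℝ) 1, ∀ i, ∀ u ∈ Ico a (a + 1), ¬ (i = i₀ ∧ u ≤ b) →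
        P + (t - a) • D + (2 * τ) • ((0, 0, ζ) - (P + (c j - a) • D)) ≠ g i u := by
    intro j
    by_cases hj : j < N
    · obtain ⟨G, hG⟩ := hG (c j) (hcab j hj)
      exact ⟨G, fun _ => hG⟩
    · exact ⟨∅, fun h => absurd h hj⟩
  choose G hG' using hG'
  obtain ⟨ζ, hζG, hζinj⟩ := exists_injOn_choice N fun j hj => (hG' j hj).1
  set w : ℕ → ℝ × ℝ × ℝ := fun j => (2 : ℝ) • ((0, 0, ζ j) - (P + (c j - a) • D)) with hw
  set Ψ := polygon (2 * N * m) (spikes N m k w) with hΨ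
  have hΨper : Function.Periodic Ψ 1 := polygon_periodic spikes_periodic
  have hΨ0 : ∀ t ∈ Icc b (a + 1), Ψ t = 0 := fun t ht => polygon_spikes_eq_zero hN0 hm0 ht
  have hdesc : ∀ t ∈ Icc a b, ∃ j < N, |t - c j| < δ ∧ ∃ σ ∈ Icc (0 : ℝ) 1, Ψ t = σ • w j := by
    intro t ht
    obtain ⟨l, h1, h2, h3⟩ : ∃ l : ℤ, 2 * N * k ≤ l ∧ l < 2 * N * k + 2 * N ∧
        t ∈ Icc (l / (2 * N * m : ℕ) : ℝ) ((l + 1) / (2 * N * m : ℕ)) := by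
      rcases ht.2.lt_or_eq with h | h
      · obtain ⟨l, h1, h2, h3⟩ := mem_grid_cell hL0 (p := 2 * N * k) (q := 2 * N * k + 2 * N)
          (t := t) ⟨haL ▸ ht.1, hbL ▸ h⟩
        exact ⟨l, h1, h2, Ico_subset_Icc_self h3⟩
      · obtain ⟨l, h1, h2, h3⟩ := mem_grid_cell' hL0 (p := 2 * N * k) (q := 2 * N * k + 2 * N)
          (t := t) ⟨by rw [← haL, h]; exact hab, hbL ▸ ht.2⟩
        exact ⟨l, h1, h2, Ioc_subset_Icc_self h3⟩
    obtain ⟨j, hj, e, he, -, h4⟩ := polygon_spikes_cell (w := w) hm0 h1 h2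
    obtain ⟨σ, hσ, h5, h6⟩ := h4 t h3
    refine ⟨j, hj, lt_of_le_of_lt ?_ hLN, σ, hσ, h6⟩
    have h7 : t - c j = -e * (1 - σ) / (2 * N * m : ℕ) := by
      rw [eq_div_iff hL'.ne', mul_comm]; exact h5
    rw [h7, abs_div, abs_of_pos hL']
    gcongr
    rw [abs_mul, abs_of_nonneg (sub_nonneg.2 hσ.2)]
    rcases he with rfl | rfl <;> norm_num <;> exact hσ.1
  have hpt : ∀ s ∈ Icc (0 : ℝ) 1, ∀ t ∈ Icc a b, ∃ j < N, |t - c j| < δ ∧ ∃ τ ∈ Icc (0 : ℝ) 1,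
      g i₀ t + s • Ψ t = P + (t - a) • D + (2 * τ) • ((0, 0, ζ j) - (P + (c j - a) • D)) := by
    intro s hs t ht
    obtain ⟨j, hj, h1, σ, hσ, h2⟩ := hdesc t ht
    refine ⟨j, hj, h1, s * σ, ⟨mul_nonneg hs.1 hσ.1, mul_le_one₀ hs.2 hσ.1 hσ.2⟩, ?_⟩
    rw [h2, haff t ht]
    simp only [hw]
    module
  refine ⟨Ψ, hΨper, polygon_isPL hL0 _, hΨ0, fun s hs => ?_, fun t ht => ?_, fun t ht => ?_⟩
  · have hoff : ∀ i, ∀ t ∈ Ico a (a + 1), ¬ (i = i₀ ∧ t ≤ b) →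
        g i t + s • (if i = i₀ then Ψ t else 0) = g i t := by
      intro i t ht hne
      split_ifs with h
      · rw [hΨ0 t ⟨(not_le.1 fun h' => hne ⟨h, h'⟩).le, ht.2.le⟩, smul_zero, add_zero]
      · rw [smul_zero, add_zero]
    have hcross : ∀ t ∈ Icc a b, ∀ i, ∀ u ∈ Ico a (a + 1), ¬ (i = i₀ ∧ u ≤ b) →
        g i₀ t + s • Ψ t ≠ g i u := by
      intro t ht i u hu hne
      obtain ⟨j, hj, h1, τ, hτ, h2⟩ := hpt s hs t ht
      rw [h2]
      exact (hG' j hj).2 _ (hζG j hj) t ht h1 τ hτ i u hu hne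
    refine InjMod.of_Ico (fun i t => ?_) a fun i j t ht u hu h => ?_
    · simp only [(hper i) t, hΨper t]
    by_cases hi : i = i₀ ∧ t ≤ b <;> by_cases hj : j = i₀ ∧ u ≤ b
    · obtain ⟨rfl, htb⟩ := hi
      obtain ⟨rfl, hub⟩ := hj
      simp only [if_true] at h
      obtain ⟨j, hj, -, τ, hτ, h2⟩ := hpt s hs t ⟨ht.1, htb⟩
      obtain ⟨j', hj', -, τ', hτ', h2'⟩ := hpt s hs u ⟨hu.1, hub⟩
      rw [h2, h2'] at h
      obtain ⟨e1, e2⟩ := segment_fingers hPD.ne h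
      refine ⟨rfl, sub_eq_zero.1 ?_⟩
      rcases mul_eq_zero.1 e2 with e2 | e2
      · rw [e1, e2]; ring
      · rw [e1, hζinj j hj j' hj' (sub_eq_zero.1 e2)]; ring
    · obtain ⟨rfl, htb⟩ := hi
      simp only [if_true] at h
      rw [hoff j u hu hj] at h
      exact absurd h (hcross t ⟨ht.1, htb⟩ j u hu hj)
    · obtain ⟨rfl, hub⟩ := hj
      simp only [if_true] at h
      rw [hoff i t ht hi] at h
      exact absurd h.symm (hcross u ⟨hu.1, hub⟩ i t ht hi)
    · rw [hoff i t ht hi, hoff j u hu hj] at h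
      obtain ⟨rfl, k', hk'⟩ := hinj _ _ _ _ h
      exact ⟨rfl, eq_of_mem_Ico ht hu hk'⟩
  · obtain ⟨l, h1, h2, h3⟩ := mem_grid_cell hL0 (p := 2 * N * k) (q := 2 * N * k + 2 * N)
      (t := t) ⟨haL ▸ ht.1, hbL ▸ ht.2⟩
    obtain ⟨j, hj, e, he, h4, h5⟩ := polygon_spikes_cell (w := w) hm0 h1 h2
    obtain ⟨σ, -, h6, h7⟩ := h5 t (Ico_subset_Icc_self h3)
    refine ⟨D + (e * (2 * N * m : ℕ)) • w j,
      (HasRight.of_affine haff ht).add (h4 ▸ polygon_hasRight hL0 _ l h3), ?_⟩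
    rw [show Ψ t = σ • w j from h7, haff t (Ico_subset_Icc_self ht), planarDet_finger he h6]
    exact neg_pos.2 hPD
  · obtain ⟨l, h1, h2, h3⟩ := mem_grid_cell' hL0 (p := 2 * N * k) (q := 2 * N * k + 2 * N)
      (t := t) ⟨haL ▸ ht.1, hbL ▸ ht.2⟩
    obtain ⟨j, hj, e, he, h4, h5⟩ := polygon_spikes_cell (w := w) hm0 h1 h2
    obtain ⟨σ, -, h6, h7⟩ := h5 t (Ioc_subset_Icc_self h3)
    refine ⟨D + (e * (2 * N * m : ℕ)) • w j,
      (HasLeft.of_affine haff ht).add (h4 ▸ polygon_hasLeft hL0 _ l h3), ?_⟩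
    rw [show Ψ t = σ • w j from h7, haff t (Ioc_subset_Icc_self ht), planarDet_finger he h6]
    exact neg_pos.2 hPD

section Cells

variable {E : Type*} [NormedAddCommGroup E] [NormedSpace ℝ E]

theorem HasRight.of_periodic {g : ℝ → E} (hg : Function.Periodic g 1) {t : ℝ} {q : E} (n : ℤ)
    (h : HasRight g (t - n) q) : HasRight g t q := by
  have e : ∀ u, g (u - n) = g u := fun u => by
    have := hg.sub_int_mul_eq n (x := u)
    rwa [mul_one] at this
  have ht : Tendsto (fun u : ℝ => u - n) (𝓝[≥] t) (𝓝[≥] (t - n)) :=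
    tendsto_nhdsWithin_iff.2 ⟨((continuous_id.sub continuous_const).tendsto t).mono_left
      nhdsWithin_le_nhds, by
        filter_upwards [self_mem_nhdsWithin] with u hu
        exact sub_le_sub_right (mem_Ici.1 hu) _⟩
  filter_upwards [ht.eventually h] with u hu
  rwa [e, e, sub_sub_sub_cancel_right] at hu

theorem HasLeft.of_periodic {g : ℝ → E} (hg : Function.Periodic g 1) {t : ℝ} {p : E} (n : ℤ)
    (h : HasLeft g (t - n) p) : HasLeft g t p := by
  have e : ∀ u, g (u - n) = g u := fun u => by
    have := hg.sub_int_mul_eq n (x := u)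
    rwa [mul_one] at this
  have ht : Tendsto (fun u : ℝ => u - n) (𝓝[≤] t) (𝓝[≤] (t - n)) :=
    tendsto_nhdsWithin_iff.2 ⟨((continuous_id.sub continuous_const).tendsto t).mono_left
      nhdsWithin_le_nhds, by
        filter_upwards [self_mem_nhdsWithin] with u hu
        exact sub_le_sub_right (mem_Iic.1 hu) _⟩
  filter_upwards [ht.eventually h] with u hu
  rwa [e, e, sub_sub_sub_cancel_right] at hu

theorem HasRight.congr {g g' : ℝ → E} {a b t : ℝ} {q : E} (h : HasRight g t q)
    (he : ∀ t ∈ Icc a b, g' t = g t) (ht : t ∈ Ico a b) : HasRight g' t q := by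
  filter_upwards [h, Icc_mem_nhdsGE ht.2] with u h1 h2
  rw [he u ⟨ht.1.trans h2.1, h2.2⟩, he t (Ico_subset_Icc_self ht), h1]

theorem HasLeft.congr {g g' : ℝ → E} {a b t : ℝ} {p : E} (h : HasLeft g t p)
    (he : ∀ t ∈ Icc a b, g' t = g t) (ht : t ∈ Ioc a b) : HasLeft g' t p := by
  filter_upwards [h, Icc_mem_nhdsLE ht.1] with u h1 h2
  rw [he u ⟨h2.1, h2.2.trans ht.2⟩, he t (Ioc_subset_Icc_self ht), h1]

/-- One-sided velocities satisfy `Q` on the interval from `a` to `b`. -/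
def VelOn (Q : E → E → Prop) (g : ℝ → E) (a b : ℝ) : Prop :=
  (∀ t ∈ Ico a b, ∃ q, HasRight g t q ∧ Q (g t) q) ∧
    ∀ t ∈ Ioc a b, ∃ p, HasLeft g t p ∧ Q (g t) p

theorem VelOn.congr {Q : E → E → Prop} {g g' : ℝ → E} {a b : ℝ} (h : VelOn Q g a b)
    (he : ∀ t ∈ Icc a b, g' t = g t) : VelOn Q g' a b := by
  refine ⟨fun t ht => ?_, fun t ht => ?_⟩
  · obtain ⟨q, h1, h2⟩ := h.1 t ht
    exact ⟨q, h1.congr he ht, by rwa [he t (Ico_subset_Icc_self ht)]⟩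
  · obtain ⟨q, h1, h2⟩ := h.2 t ht
    exact ⟨q, h1.congr he ht, by rwa [he t (Ioc_subset_Icc_self ht)]⟩

theorem VelOn.mono {Q Q' : E → E → Prop} {g : ℝ → E} {a b : ℝ} (h : VelOn Q g a b)
    (hQ : ∀ x v, Q x v → Q' x v) : VelOn Q' g a b :=
  ⟨fun t ht => let ⟨q, h1, h2⟩ := h.1 t ht; ⟨q, h1, hQ _ _ h2⟩,
    fun t ht => let ⟨q, h1, h2⟩ := h.2 t ht; ⟨q, h1, hQ _ _ h2⟩⟩

theorem VelOn.of_affine {Q : E → E → Prop} {g : ℝ → E} {a b : ℝ} {P D : E}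
    (h : ∀ t ∈ Icc a b, g t = P + (t - a) • D) (hQ : ∀ s : ℝ, Q (P + s • D) D) : VelOn Q g a b :=
  ⟨fun t ht => ⟨D, HasRight.of_affine h ht, h t (Ico_subset_Icc_self ht) ▸ hQ _⟩,
    fun t ht => ⟨D, HasLeft.of_affine h ht, h t (Ioc_subset_Icc_self ht) ▸ hQ _⟩⟩

theorem exists_velocities {Q : E → E → Prop} {g : ℝ → E} (hg : Function.Periodic g 1) {m : ℕ}
    (hm : 0 < m) (h : ∀ k : Fin m, VelOn Q g ((k : ℕ) / m) ((k + 1 : ℕ) / m)) (t : ℝ) :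
    ∃ p q, HasLeft g t p ∧ HasRight g t q ∧ Q (g t) p ∧ Q (g t) q := by
  have hm' : (m : ℝ) ≠ 0 := by exact_mod_cast hm.ne'
  have e : ∀ (n : ℤ) u, g (u - n) = g u := fun n u => by
    have := hg.sub_int_mul_eq n (x := u)
    rwa [mul_one] at this
  have hR : ∃ q, HasRight g t q ∧ Q (g t) q := by
    obtain ⟨l, h1, h2, h3⟩ := mem_grid_cell hm (p := 0) (q := m) (t := t - ⌊t⌋) (by
      rw [Int.cast_zero, zero_div, Int.cast_natCast, div_self hm']
      exact ⟨Int.fract_nonneg t, Int.fract_lt_one t⟩)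
    lift l to ℕ using h1
    obtain ⟨q, h4, h5⟩ := (h ⟨l, by exact_mod_cast h2⟩).1 (t - ⌊t⌋) (by exact_mod_cast h3)
    exact ⟨q, h4.of_periodic hg, by rwa [e] at h5⟩
  have hL : ∃ p, HasLeft g t p ∧ Q (g t) p := by
    obtain ⟨l, h1, h2, h3⟩ := mem_grid_cell' hm (p := 0) (q := m) (t := t - (⌈t⌉ - 1 : ℤ)) (by
      rw [Int.cast_zero, zero_div, Int.cast_natCast, div_self hm']
      push_cast
      constructor <;> linarith [Int.ceil_lt_add_one t, Int.le_ceil t])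
    lift l to ℕ using h1
    obtain ⟨q, h4, h5⟩ := (h ⟨l, by exact_mod_cast h2⟩).2 _ (by exact_mod_cast h3)
    exact ⟨q, h4.of_periodic hg, by rwa [e] at h5⟩
  obtain ⟨p, hp, hp'⟩ := hL
  obtain ⟨q, hq, hq'⟩ := hR
  exact ⟨p, q, hp, hq, hp', hq'⟩

end Cells

theorem planarDet_affine (P D : ℝ × ℝ × ℝ) (s : ℝ) : planarDet (P + s • D) D = planarDet P D := by
  rw [planarDet_add_smul, show planarDet D D = 0 by simp only [planarDet]; ring, mul_zero, add_zero]

theorem exists_positive_polygon {ι : Type*} [Finite ι] {m : ℕ} (hm : 1 < m)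
    (S : Finset (ι × Fin m)) : ∀ g : ι → ℝ → ℝ × ℝ × ℝ, (∀ i, Function.Periodic (g i) 1) →
      InjMod g →
      (∀ i k, (i, k) ∈ S → ∃ P D, planarDet P D < 0 ∧
        ∀ t ∈ Icc ((k : ℕ) / m : ℝ) ((k + 1 : ℕ) / m), g i t = P + (t - (k : ℕ) / m) • D) →
      (∀ i k, (i, k) ∉ S →
        VelOn (fun x v => 0 < planarDet x v) (g i) ((k : ℕ) / m) ((k + 1 : ℕ) / m)) →
      ∃ g' : ι → ℝ → ℝ × ℝ × ℝ, (∀ i, Function.Periodic (g' i) 1) ∧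
        (∀ i t, ∃ p q, HasLeft (g' i) t p ∧ HasRight (g' i) t q ∧
          0 < planarDet (g' i t) p ∧ 0 < planarDet (g' i t) q) ∧
        ∃ ε > 0, ∀ φ : ContDiffBump (0 : ℝ), φ.rOut < ε → ∀ f,
          Isotopic f (fun i => mollify φ (g i)) → Isotopic f fun i => mollify φ (g' i) := by
  classical
  have hm0 : 0 < m := by omega
  have hm' : (0 : ℝ) < m := by exact_mod_cast hm0
  induction S using Finset.induction_on with
  | empty =>
    intro g hper _ _ hpos
    exact ⟨g, hper,
      fun i => exists_velocities (hper i) hm0 fun k => hpos i k (Finset.notMem_empty _),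
      1, one_pos, fun _ _ _ h => h⟩
  | insert x S hx ih =>
    obtain ⟨i₀, k₀⟩ := x
    intro g hper hinj hneg hpos
    have hgen : ∀ i, Generic (g i) := fun i => by
      refine exists_velocities (Q := fun x v => planarDet x v ≠ 0) (hper i) hm0 fun k => ?_
      by_cases hk : (i, k) ∈ insert (i₀, k₀) S
      · obtain ⟨P, D, h1, h2⟩ := hneg i k hk
        exact VelOn.of_affine h2 fun s => by rw [planarDet_affine]; exact h1.ne
      · exact (hpos i k hk).mono fun x v h => h.ne'
    obtain ⟨P, D, hPD, haff⟩ := hneg i₀ k₀ (Finset.mem_insert_self _ _)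
    obtain ⟨Ψ, hΨper, hΨPL, hΨ0, hΨinj, hΨR, hΨL⟩ := exists_finger hper hinj hgen i₀ hm
      ((k₀ : ℕ) : ℤ) hPD (by simpa only [Int.cast_natCast, Nat.cast_add, Nat.cast_one] using haff)
    set h : ι → ℝ → ℝ × ℝ × ℝ := fun i t => if i = i₀ then Ψ t else 0 with hh
    have hh0 : ∀ i, i ≠ i₀ → ∀ t, h i t = 0 := fun i hi t => if_neg hi
    have hhPL : ∀ i, IsPL (h i) := fun i => by
      by_cases hi : i = i₀
      · simpa only [hh, hi, if_true] using hΨPL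
      · simp only [hh, hi, if_false]
        exact fun t => ⟨0, 0, by simp, by simp⟩
    have hhper : ∀ i, Function.Periodic (h i) 1 := fun i t => by
      simp only [hh, hΨper t]
    have htame : ∀ s ∈ Icc (0 : ℝ) 1, Tame fun i t => g i t + s • h i t := fun s hs =>
      IsPL.tame (fun i => (hgen i).isPL.add ((hhPL i).const_smul s))
        (fun i t => by simp only [(hper i) t, (hhper i) t]) (hΨinj s hs)
    obtain ⟨K, hK⟩ := exists_lipschitzWith_forall fun i =>
      exists_lipschitzWith_of_periodic (hhper i) (hhPL i).locallyLipschitz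
    obtain ⟨ε₁, hε₁, hiso⟩ := exists_isotopic_mollify hK htame
    have hsame : ∀ i (k : Fin m), (i, k) ≠ (i₀, k₀) →
        ∀ t ∈ Icc ((k : ℕ) / m : ℝ) ((k + 1 : ℕ) / m), g i t + h i t = g i t := by
      intro i k hik t ht
      by_cases hi : i = i₀
      · subst hi
        have hk : (k : ℕ) ≠ k₀ := fun h => hik (by rw [Fin.ext h])
        have hkm : ((k : ℕ) : ℝ) + 1 ≤ m := by exact_mod_cast k.2
        have hkm' : ((k₀ : ℕ) : ℝ) + 1 ≤ m := by exact_mod_cast k₀.2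
        have hk0 : (0 : ℝ) ≤ (k : ℕ) := by positivity
        have hk0' : (0 : ℝ) ≤ (k₀ : ℕ) := by positivity
        have ht1 := ht.1
        have ht2 := ht.2
        rw [div_le_iff₀ hm'] at ht1
        rw [le_div_iff₀ hm'] at ht2
        push_cast at ht2
        have : Ψ t = 0 := by
          rcases lt_or_gt_of_ne hk with hlt | hlt
          · have hlt : ((k : ℕ) : ℝ) + 1 ≤ (k₀ : ℕ) := by exact_mod_cast hlt
            rw [← hΨper t]
            refine hΨ0 _ ⟨?_, ?_⟩
            · rw [div_le_iff₀ hm']; push_cast; linarith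
            · rw [← sub_le_iff_le_add, le_div_iff₀ hm']; push_cast; linarith
          · have hlt : ((k₀ : ℕ) : ℝ) + 1 ≤ (k : ℕ) := by exact_mod_cast hlt
            refine hΨ0 _ ⟨?_, ?_⟩
            · rw [div_le_iff₀ hm']; push_cast; linarith
            · rw [← sub_le_iff_le_add, le_div_iff₀ hm']; push_cast; linarith
        simp [hh, this]
      · rw [hh0 i hi, add_zero]
    obtain ⟨g', hper', hvel', ε₂, hε₂, hiso'⟩ := ih (fun i t => g i t + h i t)
      (fun i t => by simp only [(hper i) t, (hhper i) t])
      (by simpa only [one_smul] using hΨinj 1 ⟨zero_le_one, le_rfl⟩)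
      (fun i k hik => by
        obtain ⟨P, D, h1, h2⟩ := hneg i k (Finset.mem_insert_of_mem hik)
        refine ⟨P, D, h1, fun t ht => ?_⟩
        have : (i, k) ≠ (i₀, k₀) := fun h => hx (h ▸ hik)
        exact (hsame i k this t ht).trans (h2 t ht))
      (fun i k hik => by
        by_cases hk : (i, k) = (i₀, k₀)
        · obtain ⟨rfl, rfl⟩ := Prod.ext_iff.1 hk
          have e : (fun t => g i t + h i t) = fun t => g i t + Ψ t := by
            simp [hh]
          change VelOn _ (fun t => g i t + h i t) _ _
          rw [e]
          rw [Int.cast_natCast] at hΨR hΨL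
          rw [Nat.cast_add, Nat.cast_one]
          exact ⟨hΨR, hΨL⟩
        · exact (hpos i k fun h => (Finset.mem_insert.1 h).elim hk hik).congr (hsame i k hk))
    refine ⟨g', hper', hvel', min ε₁ ε₂, lt_min hε₁ hε₂, fun φ hφ f hf => ?_⟩
    exact hiso' φ (hφ.trans_le (min_le_right _ _)) f
      (hf.trans (hiso φ (hφ.trans_le (min_le_left _ _))))

/-- Every smooth link is isotopic to the mollification of a positive polygonal loop. -/
theorem exists_isotopic_mollify_positive {ι : Type*} [Finite ι] {f : ι → ℝ → ℝ × ℝ × ℝ}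
    (hf : IsLoopLink f) :
    ∃ g : ι → ℝ → ℝ × ℝ × ℝ, (∀ i, Function.Periodic (g i) 1) ∧
      (∀ i t, ∃ p q, HasLeft (g i) t p ∧ HasRight (g i) t q ∧
        0 < planarDet (g i t) p ∧ 0 < planarDet (g i t) q) ∧
      ∃ ε > 0, ∀ φ : ContDiffBump (0 : ℝ), φ.rOut < ε → Isotopic f fun i => mollify φ (g i) := by
  classical
  obtain ⟨m, g, hm, hper, hPL, hcell, htame⟩ := exists_generic_polygon hf
  have := Fintype.ofFinite ι
  choose P D hPD haff using hcell
  obtain ⟨K, hK⟩ := exists_lipschitzWith_forall fun i =>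
    exists_lipschitzWith_of_periodic (hper i) (hPL i).locallyLipschitz
  obtain ⟨K', hK'⟩ := hf.tame.lipschitz
  obtain ⟨ε₁, hε₁, hiso₁⟩ := exists_isotopic_mollify_self hf.tame hf.smooth
  obtain ⟨ε₂, hε₂, hiso₂⟩ := exists_isotopic_mollify (fun i => (hK i).sub (hK' i)) htame
  have hinj : InjMod g := by
    simpa using (htame 1 ⟨zero_le_one, le_rfl⟩).inj
  obtain ⟨g', hper', hvel', ε₃, hε₃, hiso₃⟩ := exists_positive_polygon hm
    (Finset.univ.filter fun x : ι × Fin m => planarDet (P x.1 (x.2 : ℕ)) (D x.1 (x.2 : ℕ)) < 0)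
    g hper hinj (fun i k hik => ⟨P i (k : ℕ), D i (k : ℕ), by simpa using hik, by
      simpa only [Int.cast_natCast, Nat.cast_add, Nat.cast_one] using haff i (k : ℕ)⟩)
    fun i k hik =>
      VelOn.of_affine (P := P i (k : ℕ)) (D := D i (k : ℕ)) (by
        simpa only [Int.cast_natCast, Nat.cast_add, Nat.cast_one] using haff i (k : ℕ))
        fun s => by
          rw [planarDet_affine]
          exact lt_of_le_of_ne (by simpa using hik) (hPD i _).symm
  refine ⟨g', hper', hvel', min ε₁ (min ε₂ ε₃), lt_min hε₁ (lt_min hε₂ hε₃), fun φ hφ => ?_⟩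
  rw [lt_min_iff, lt_min_iff] at hφ
  refine hiso₃ φ hφ.2.2 f ((hiso₁ φ hφ.1).trans ?_)
  simpa using hiso₂ φ hφ.2.1

/-- The planar determinant with a fixed first vector, as a linear form. -/
noncomputable def planarForm (x : ℝ × ℝ × ℝ) : ℝ × ℝ × ℝ →L[ℝ] ℝ :=
  x.1 • (ContinuousLinearMap.fst ℝ ℝ ℝ).comp (ContinuousLinearMap.snd ℝ ℝ (ℝ × ℝ)) -
    x.2.1 • ContinuousLinearMap.fst ℝ ℝ (ℝ × ℝ)

theorem abs_planarDet_le (x v : ℝ × ℝ × ℝ) : |planarDet x v| ≤ 2 * ‖x‖ * ‖v‖ := by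
  have h1 : |x.1| ≤ ‖x‖ := norm_fst_le x
  have h2 : |x.2.1| ≤ ‖x‖ := (norm_fst_le x.2).trans (norm_snd_le x)
  have h3 : |v.1| ≤ ‖v‖ := norm_fst_le v
  have h4 : |v.2.1| ≤ ‖v‖ := (norm_fst_le v.2).trans (norm_snd_le v)
  have h5 : |x.1 * v.2.1| ≤ ‖x‖ * ‖v‖ := by rw [abs_mul]; gcongr
  have h6 : |x.2.1 * v.1| ≤ ‖x‖ * ‖v‖ := by rw [abs_mul]; gcongr
  have := abs_sub (x.1 * v.2.1) (x.2.1 * v.1)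
  unfold planarDet
  linarith

theorem exists_monoNear {E : Type*} [NormedAddCommGroup E] [NormedSpace ℝ E] {g : ℝ → E} {x : ℝ}
    {p q : E} (hp : HasLeft g x p) (hq : HasRight g x q) {ℓ : E →L[ℝ] ℝ} {c : ℝ} (hcp : c ≤ ℓ p)
    (hcq : c ≤ ℓ q) : ∃ r > 0, MonoNear ℓ g c x r := by
  obtain ⟨a, ha, hp⟩ := (mem_nhdsLE_iff_exists_Icc_subset).1 hp
  obtain ⟨b, hb, hq⟩ := (mem_nhdsGE_iff_exists_Icc_subset).1 hq
  have ha : a < x := ha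
  have hb : x < b := hb
  have m1 := min_le_left (x - a) (b - x)
  have m2 := min_le_right (x - a) (b - x)
  refine ⟨min (x - a) (b - x), lt_min (by linarith) (by linarith), fun t u h1 h2 h3 => ?_⟩
  have hp : ∀ t, a ≤ t → t ≤ x → g t = g x + (t - x) • p := fun t h h' => hp ⟨h, h'⟩
  have hq : ∀ t, x ≤ t → t ≤ b → g t = g x + (t - x) • q := fun t h h' => hq ⟨h, h'⟩
  rw [map_sub]
  rcases le_total u x with hux | hux
  · rw [hp t (by linarith) (h2.trans hux), hp u (by linarith) hux]
    simp only [map_add, map_smul, smul_eq_mul]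
    nlinarith
  rcases le_total t x with htx | htx
  · rw [hp t (by linarith) htx, hq u hux (by linarith)]
    simp only [map_add, map_smul, smul_eq_mul]
    nlinarith
  · rw [hq t htx (by linarith), hq u hux (by linarith)]
    simp only [map_add, map_smul, smul_eq_mul]
    nlinarith

/-- Mollifying a positive polygonal loop preserves positivity. -/
theorem eventually_mollify_positive {g : ℝ → ℝ × ℝ × ℝ} (hper : Function.Periodic g 1)
    (hvel : ∀ t, ∃ p q, HasLeft g t p ∧ HasRight g t q ∧
      0 < planarDet (g t) p ∧ 0 < planarDet (g t) q) :
    ∀ᶠ ε in 𝓝[>] (0 : ℝ), ∀ φ : ContDiffBump (0 : ℝ), φ.rOut < ε →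
      ∀ t, 0 < planarDet (mollify φ g t) (deriv (mollify φ g) t) := by
  have hPL : IsPL g := fun t => let ⟨p, q, hp, hq, _⟩ := hvel t; ⟨p, q, hp, hq⟩
  obtain ⟨K, hK⟩ := exists_lipschitzWith_of_periodic hper hPL.locallyLipschitz
  have loc : ∀ x, ∃ ρ > 0, ∀ φ : ContDiffBump (0 : ℝ), φ.rOut < ρ → ∀ t, |t - x| < ρ →
      0 < planarDet (mollify φ g t) (deriv (mollify φ g) t) := by
    intro x
    obtain ⟨p, q, hp, hq, hp0, hq0⟩ := hvel x
    set c := min (planarDet (g x) p) (planarDet (g x) q) with hc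
    have hc0 : 0 < c := lt_min hp0 hq0
    obtain ⟨r, hr, hmono⟩ := exists_monoNear hp hq (ℓ := planarForm (g x)) (min_le_left _ _)
      (min_le_right _ _)
    have hK0 : (0 : ℝ) ≤ K := K.2
    refine ⟨min (r / 2) (c / (4 * K ^ 2 + 1)), lt_min (by linarith) (by positivity),
      fun φ hφ t ht => ?_⟩
    rw [lt_min_iff] at hφ ht
    have h1 := ht.2
    have h2 := hφ.2
    rw [lt_div_iff₀ (by positivity)] at h1 h2
    have hdiff := (mollify_contDiff φ hK.continuous).differentiable (by simp)
    have h3 : c ≤ planarDet (g x) (deriv (mollify φ g) t) :=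
      (hmono.mollify hK.continuous φ (r' := r / 2) (by linarith)).le_deriv ht.1 (hdiff t)
    have h4 : ‖deriv (mollify φ g) t‖ ≤ K := norm_deriv_le_of_lipschitz (mollify_lipschitz φ hK)
    have h5 : ‖mollify φ g t - g x‖ ≤ K * φ.rOut + K * |t - x| := by
      have := norm_sub_le_norm_sub_add_norm_sub (mollify φ g t) (g t) (g x)
      have h6 := norm_mollify_sub_le φ hK t
      have h7 := hK.norm_sub_le t x
      rw [Real.norm_eq_abs] at h7
      linarith
    have h6 := abs_le.1 (abs_planarDet_le (mollify φ g t - g x) (deriv (mollify φ g) t))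
    have h9 := φ.rOut_pos
    have h10 := abs_nonneg (t - x)
    have h7 : 2 * ‖mollify φ g t - g x‖ * ‖deriv (mollify φ g) t‖
        ≤ 2 * (K * φ.rOut + K * |t - x|) * K := by
      gcongr
    have h8 : planarDet (mollify φ g t) (deriv (mollify φ g) t)
        = planarDet (g x) (deriv (mollify φ g) t)
          + planarDet (mollify φ g t - g x) (deriv (mollify φ g) t) := by
      simp only [planarDet, Prod.fst_sub, Prod.snd_sub]
      ring
    rw [h8]
    nlinarith
  have key : ∃ ρ > 0, ∀ φ : ContDiffBump (0 : ℝ), φ.rOut < ρ → ∀ t ∈ Icc (0 : ℝ) 1,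
      0 < planarDet (mollify φ g t) (deriv (mollify φ g) t) := by
    refine isCompact_Icc.induction_on (p := fun s => ∃ ρ > 0, ∀ φ : ContDiffBump (0 : ℝ),
      φ.rOut < ρ → ∀ t ∈ s, 0 < planarDet (mollify φ g t) (deriv (mollify φ g) t))
      ⟨1, one_pos, fun _ _ _ h => absurd h (notMem_empty _)⟩ ?_ ?_ fun x _ => ?_
    · rintro s s' hs ⟨ρ, hρ, h⟩
      exact ⟨ρ, hρ, fun φ hφ t ht => h φ hφ t (hs ht)⟩
    · rintro s s' ⟨ρ, hρ, h⟩ ⟨ρ', hρ', h'⟩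
      refine ⟨min ρ ρ', lt_min hρ hρ', fun φ hφ t ht => ?_⟩
      rw [lt_min_iff] at hφ
      exact ht.elim (h φ hφ.1 t) (h' φ hφ.2 t)
    · obtain ⟨ρ, hρ, h⟩ := loc x
      exact ⟨_, nhdsWithin_le_nhds (Metric.ball_mem_nhds x hρ), ρ, hρ, fun φ hφ t ht => h φ hφ t ht⟩
  obtain ⟨ρ, hρ, h⟩ := key
  filter_upwards [Ioo_mem_nhdsGT hρ] with ε hε φ hφ t
  have e1 := (mollify_periodic φ hper).sub_int_mul_eq ⌊t⌋ (x := t)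
  have e2 := (deriv_periodic (mollify_periodic φ hper)).sub_int_mul_eq ⌊t⌋ (x := t)
  rw [mul_one] at e1 e2
  rw [← e1, ← e2]
  exact h φ (hφ.trans hε.2) _ ⟨Int.fract_nonneg t, (Int.fract_lt_one t).le⟩

theorem exists_isotopic_braided {ι : Type*} [Finite ι] {f : ι → ℝ → ℝ × ℝ × ℝ}
    (hf : IsLoopLink f) :
    ∃ g, Isotopic f g ∧ ∀ i t, 0 < planarDet (g i t) (deriv (g i) t) := by
  obtain ⟨g, hper, hvel, ε₁, hε₁, hiso⟩ := exists_isotopic_mollify_positive hf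
  obtain ⟨ε, hpos, hε0, hε⟩ := ((eventually_all.2 fun i =>
    eventually_mollify_positive (hper i) (hvel i)).and (Ioo_mem_nhdsGT hε₁)).exists
  let φ : ContDiffBump (0 : ℝ) := ⟨ε / 4, ε / 2, by linarith, by linarith⟩
  have hφ : φ.rOut < ε := by change ε / 2 < ε; linarith
  exact ⟨_, hiso φ (hφ.trans hε), fun i => hpos i φ hφ⟩

/-- The one-periodic loops traced by the components of a smooth link. -/
theorem isLoopLink_of_isSmoothLink {n : ℕ} {L : Fin n × Circle → ℝ × ℝ × ℝ}
    (hL : IsSmoothLink L) : IsLoopLink fun i t => componentLoop L i (2 * π * t) where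
  periodic i t := by
    change L (i, Circle.exp (2 * π * (t + 1))) = L (i, Circle.exp (2 * π * t))
    rw [mul_add, mul_one, Circle.periodic_exp]
  smooth i := (hL.2 i).1.comp (contDiff_const.mul contDiff_id)
  deriv_ne i t := by
    rw [deriv_comp_mul_left (2 * π) (componentLoop L i)]
    exact smul_ne_zero (by positivity) ((hL.2 i).2 _)
  inj i j t u h := by
    have h1 := hL.1 h
    rw [Prod.mk.injEq, Circle.exp_eq_exp] at h1
    obtain ⟨hij, m, hm⟩ := h1
    exact ⟨hij, m, mul_left_cancel₀ Real.two_pi_pos.ne' (by linarith)⟩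

/-- The map on `Fin n × Circle` given by a family of one-periodic loops. -/
noncomputable def ofLoops {n : ℕ} (f : Fin n → ℝ → ℝ × ℝ × ℝ) (q : Fin n × Circle) :
    ℝ × ℝ × ℝ :=
  f q.1 (Complex.arg q.2 / (2 * π))

theorem componentLoop_ofLoops {n : ℕ} {f : Fin n → ℝ → ℝ × ℝ × ℝ} (hf : IsLoopLink f)
    (i : Fin n) (t : ℝ) : componentLoop (ofLoops f) i t = f i (t / (2 * π)) := by
  obtain ⟨m, hm⟩ := Circle.exp_eq_exp.1 (Circle.exp_arg (Circle.exp t))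
  change f i (Complex.arg (Circle.exp t) / (2 * π)) = _
  rw [hm, add_div, mul_div_cancel_right₀ _ Real.two_pi_pos.ne']
  simpa using (hf.periodic i).int_mul m (t / (2 * π))

theorem ofLoops_componentLoop {n : ℕ} (L : Fin n × Circle → ℝ × ℝ × ℝ) :
    ofLoops (fun i t => componentLoop L i (2 * π * t)) = L := by
  ext1 ⟨i, z⟩
  change L (i, Circle.exp (2 * π * (Complex.arg z / (2 * π)))) = _
  rw [mul_div_cancel₀ _ Real.two_pi_pos.ne', Circle.exp_arg]

theorem hasDerivAt_componentLoop_ofLoops {n : ℕ} {f : Fin n → ℝ → ℝ × ℝ × ℝ}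
    (hf : IsLoopLink f) (i : Fin n) (t : ℝ) :
    HasDerivAt (componentLoop (ofLoops f) i)
      ((2 * π)⁻¹ • deriv (f i) (t / (2 * π))) t := by
  have h := ((hf.smooth i).differentiable (by simp) (t / (2 * π))).hasDerivAt.scomp t
    ((hasDerivAt_id t).div_const (2 * π))
  rw [one_div] at h
  exact h.congr_of_eventuallyEq (.of_forall (componentLoop_ofLoops hf i))

theorem isSmoothLink_ofLoops {n : ℕ} {f : Fin n → ℝ → ℝ × ℝ × ℝ} (hf : IsLoopLink f) :
    IsSmoothLink (ofLoops f) := by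
  refine ⟨?_, fun i => ⟨?_, fun t => ?_⟩⟩
  · rintro ⟨i, z⟩ ⟨j, w⟩ h
    obtain ⟨hij, k, hk⟩ := hf.inj i j _ _ h
    rw [div_eq_iff Real.two_pi_pos.ne', add_mul,
      div_mul_cancel₀ _ Real.two_pi_pos.ne'] at hk
    rw [Prod.mk.injEq, ← Circle.exp_arg z, ← Circle.exp_arg w]
    exact ⟨hij, Circle.exp_eq_exp.2 ⟨k, hk⟩⟩
  · rw [funext (componentLoop_ofLoops hf i)]
    exact (hf.smooth i).comp (contDiff_id.div_const _)
  · rw [(hasDerivAt_componentLoop_ofLoops hf i t).deriv]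
    exact smul_ne_zero (by positivity) (hf.deriv_ne i _)

theorem isBraided_ofLoops {n : ℕ} {f : Fin n → ℝ → ℝ × ℝ × ℝ} (hf : IsLoopLink f)
    (hpos : ∀ i t, 0 < planarDet (f i t) (deriv (f i) t)) : IsBraided (ofLoops f) := by
  refine ⟨fun i t h => ?_, fun i t => ?_⟩
  · rw [componentLoop_ofLoops hf, Prod.mk.injEq] at h
    simpa [planarDet, h.1, h.2] using hpos i (t / (2 * π))
  · have h := hasDerivAt_componentLoop_ofLoops hf i t
    have h1 : HasDerivAt (fun s => (componentLoop (ofLoops f) i s).1) _ t :=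
      (ContinuousLinearMap.fst ℝ ℝ (ℝ × ℝ)).hasFDerivAt.comp_hasDerivAt t h
    have h2 : HasDerivAt (fun s => (componentLoop (ofLoops f) i s).2.1) _ t :=
      ((ContinuousLinearMap.fst ℝ ℝ ℝ).comp
        (ContinuousLinearMap.snd ℝ ℝ (ℝ × ℝ))).hasFDerivAt.comp_hasDerivAt t h
    rw [h1.deriv, h2.deriv, componentLoop_ofLoops hf]
    have := mul_pos (inv_pos.2 Real.two_pi_pos) (hpos i (t / (2 * π)))
    simp only [planarDet] at this
    simp only [ContinuousLinearMap.comp_apply, ContinuousLinearMap.coe_fst',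
      ContinuousLinearMap.coe_snd', Prod.smul_fst, Prod.smul_snd, smul_eq_mul]
    linarith

end LinkBraiding

open LinkBraiding

/-- Every smooth link in ℝ³ can be smoothly isotoped, through smooth links,
to a link braided about the z-axis. -/
theorem smooth_link_braiding {n : ℕ} (hn : 1 ≤ n)
    (L : Fin n × Circle → ℝ × ℝ × ℝ) (hL : IsSmoothLink L) :
    ∃ H : ℝ × (Fin n × Circle) → ℝ × ℝ × ℝ,
      (∀ i : Fin n, ContDiff ℝ (⊤ : ℕ∞) (fun p : ℝ × ℝ => H (p.1, (i, Circle.exp p.2)))) ∧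
      (∀ q, H (0, q) = L q) ∧
      (∀ s ∈ Set.Icc (0 : ℝ) 1, IsSmoothLink (fun q => H (s, q))) ∧
      IsBraided (fun q => H (1, q)) := by
  obtain ⟨g, ⟨H, hH, h0, h1, hlink⟩, hg⟩ :=
    exists_isotopic_braided (isLoopLink_of_isSmoothLink hL)
  refine ⟨fun p => ofLoops (H p.1) p.2, fun i => ?_, fun q => ?_,
    fun s _ => isSmoothLink_ofLoops (hlink s), ?_⟩
  · change ContDiff ℝ (⊤ : ℕ∞) fun p : ℝ × ℝ => componentLoop (ofLoops (H p.1)) i p.2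
    simp only [componentLoop_ofLoops (hlink _)]
    exact (hH i).comp (contDiff_fst.prodMk (contDiff_snd.div_const (2 * Real.pi)))
  · change ofLoops (H 0) q = L q
    rw [h0 0 le_rfl, ofLoops_componentLoop]
  · have hg1 := h1 1 le_rfl
    exact isBraided_ofLoops (hlink 1) (hg1 ▸ hg)
end
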